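/- Let V : (0,∞) → ℝ satisfy |V(r)| ≲ ⟨r⟩^{-4} and |V′(r)| ≲ ⟨r⟩^{-5}, and let m(r,ρ) be the solution of the Volterra integral equation m(r,ρ) = 1 + ∫_r^∞ ((e^{2iρ(r′−r)} − 1)/(2iρ)) V(r′) m(r′,ρ) dr′ for r ≥ 0. Then for all r > 0 and all sufficiently large ρ: |m(r,ρ) − 1| ≲ ρ^{-1}⟨r⟩^{-3}, |∂_r m(r,ρ)| ≲ ρ^{-1}⟨r⟩^{-4}, and |∂_ρ^ℓ m(r,ρ)| ≲ ρ^{-1}⟨r⟩^{-4+ℓ} for ℓ = 1, 2, 3, where the implicit constants depend only on V. -/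

import Mathlib

noncomputable section

open MeasureTheory Set

/-- The Japanese bracket `⟨r⟩ = (1 + r²)^{1/2}`. -/
def jbR (r : ℝ) : ℝ := Real.sqrt (1 + r ^ 2)


namespace JostBounds

open Filter Topology
open scoped BoundedContinuousFunction

/-! ### Weighted tail integrals -/

lemma integrableOn_one_add_rpow {a r : ℝ} (ha : a < -1) (hr : 0 ≤ r) :
    IntegrableOn (fun s : ℝ => (1 + s) ^ a) (Ioi r) := by
  simpa [add_comm] using integrableOn_add_rpow_Ioi_of_lt (m := 1) ha (by linarith : -1 < r)

lemma integral_one_add_rpow {a r : ℝ} (ha : a < -1) (hr : 0 ≤ r) :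
    ∫ s in Ioi r, (1 + s) ^ a = (1 + r) ^ (a + 1) / (-a - 1) := by
  have hd : ∀ s ∈ Ici r, HasDerivAt (fun s : ℝ => (1 + s) ^ (a + 1) / (a + 1)) ((1 + s) ^ a) s := by
    intro s hs
    have h1 : 0 < 1 + s := by linarith [mem_Ici.1 hs]
    have := (((hasDerivAt_id s).const_add 1).rpow_const (p := a + 1) (Or.inl h1.ne')).div_const
      (a + 1)
    refine this.congr_deriv ?_
    rw [add_sub_cancel_right, one_mul, mul_div_cancel_left₀ _ (by linarith : a + 1 ≠ 0)]
    rfl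
  have hlim : Tendsto (fun s : ℝ => (1 + s) ^ (a + 1) / (a + 1)) atTop (𝓝 (0 / (a + 1))) := by
    refine Tendsto.div_const ?_ _
    have h := (tendsto_rpow_neg_atTop (y := -(a + 1)) (by linarith)).comp
      (tendsto_atTop_add_const_left atTop (1 : ℝ) tendsto_id)
    simpa [Function.comp_def] using h
  rw [integral_Ioi_of_hasDerivAt_of_tendsto' hd (integrableOn_one_add_rpow ha hr) hlim]
  have h1 : a + 1 ≠ 0 := by linarith
  have h2 : -a - 1 ≠ 0 := by linarith
  field_simp
  ring

/-- `w` is measurable on `(0, ∞)` and decays like `(1 + s) ^ (-p)`. -/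
def Decays (w : ℝ → ℂ) (C p : ℝ) : Prop :=
  AEStronglyMeasurable w (volume.restrict (Ioi 0)) ∧ 0 ≤ C ∧
    ∀ s : ℝ, 0 < s → ‖w s‖ ≤ C * (1 + s) ^ (-p)

/-- `κ` is a continuous kernel with `κ t = O(t ^ q)`. -/
def Grows (κ : ℝ → ℂ) (B q : ℝ) : Prop :=
  Continuous κ ∧ 0 ≤ B ∧ 0 ≤ q ∧ ∀ t : ℝ, 0 ≤ t → ‖κ t‖ ≤ B * t ^ q

/-- The weighted Volterra integral operator on the half-line, in the variable `r = exp x`. -/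
def volterra (β : ℝ) (κ w φ : ℝ → ℂ) (x : ℝ) : ℂ :=
  (((1 + Real.exp x) ^ β : ℝ) : ℂ) *
    ∫ s in Ioi (Real.exp x), κ (s - Real.exp x) * w s * φ (Real.log s)

lemma norm_kernel_mul_le {κ w φ : ℝ → ℂ} {B q C p N : ℝ} (hκ : Grows κ B q) (hw : Decays w C p)
    (hφ : ∀ x, ‖φ x‖ ≤ N) {r s : ℝ} (hr : 0 ≤ r) (hs : r < s) :
    ‖κ (s - r) * w s * φ (Real.log s)‖ ≤ B * C * N * (1 + s) ^ (q - p) := by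
  obtain ⟨-, hB, hq, hκ⟩ := hκ
  obtain ⟨-, hC, hw⟩ := hw
  have h1 : 0 < 1 + s := by linarith
  have h2 : ‖κ (s - r)‖ ≤ B * (1 + s) ^ q := (hκ _ (by linarith)).trans (by
    gcongr
    linarith)
  have h3 := hw s (by linarith)
  rw [norm_mul, norm_mul]
  calc ‖κ (s - r)‖ * ‖w s‖ * ‖φ (Real.log s)‖
      ≤ (B * (1 + s) ^ q) * (C * (1 + s) ^ (-p)) * N := by
        gcongr
        exact hφ _
    _ = B * C * N * ((1 + s) ^ q * (1 + s) ^ (-p)) := by ring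
    _ = _ := by rw [← Real.rpow_add h1, sub_eq_add_neg]

lemma aestronglyMeasurable_kernel_mul {κ w φ : ℝ → ℂ} {C p : ℝ} (hκ : Continuous κ)
    (hw : Decays w C p) (hφ : Continuous φ) (r : ℝ) :
    AEStronglyMeasurable (fun s => κ (s - r) * w s * φ (Real.log s)) (volume.restrict (Ioi 0)) :=
  ((by fun_prop : Continuous fun s => κ (s - r)).aestronglyMeasurable.mul hw.1).mul
    (hφ.measurable.comp Real.measurable_log).aestronglyMeasurable

lemma integrableOn_kernel_mul {κ w φ : ℝ → ℂ} {B q C p N : ℝ} (hκ : Grows κ B q)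
    (hw : Decays w C p) (hφc : Continuous φ) (hφ : ∀ x, ‖φ x‖ ≤ N) (hpq : q + 1 < p)
    {r : ℝ} (hr : 0 ≤ r) :
    IntegrableOn (fun s => κ (s - r) * w s * φ (Real.log s)) (Ioi r) := by
  refine Integrable.mono' ((integrableOn_one_add_rpow (a := q - p) (by linarith) hr).const_mul
    (B * C * N)) ((aestronglyMeasurable_kernel_mul hκ.1 hw hφc r).mono_measure
      (Measure.restrict_mono (Ioi_subset_Ioi hr) le_rfl)) ?_
  filter_upwards [ae_restrict_mem measurableSet_Ioi] with s hs
  exact norm_kernel_mul_le hκ hw hφ hr hs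

lemma norm_volterra_le {κ w φ : ℝ → ℂ} {B q C p N β : ℝ} (hκ : Grows κ B q)
    (hw : Decays w C p) (hφ : ∀ x, ‖φ x‖ ≤ N) (hpq : q + 1 < p) (x : ℝ) :
    ‖volterra β κ w φ x‖ ≤
      B * C / (p - q - 1) * (1 + Real.exp x) ^ (β + q + 1 - p) * N := by
  have hx := Real.exp_pos x
  have hy : 0 < 1 + Real.exp x := by linarith
  have h1 : ‖∫ s in Ioi (Real.exp x), κ (s - Real.exp x) * w s * φ (Real.log s)‖ ≤
      ∫ s in Ioi (Real.exp x), B * C * N * (1 + s) ^ (q - p) := by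
    refine norm_integral_le_of_norm_le
      ((integrableOn_one_add_rpow (a := q - p) (by linarith) hx.le).const_mul _) ?_
    filter_upwards [ae_restrict_mem measurableSet_Ioi] with s hs
    exact norm_kernel_mul_le hκ hw hφ hx.le hs
  rw [integral_const_mul, integral_one_add_rpow (by linarith) hx.le] at h1
  rw [volterra, norm_mul, Complex.norm_real, Real.norm_of_nonneg (by positivity)]
  calc _ ≤ (1 + Real.exp x) ^ β * (B * C * N * ((1 + Real.exp x) ^ (q - p + 1) /
        (-(q - p) - 1))) := by gcongr
    _ = _ := by
      have e : (1 + Real.exp x) ^ (β + q + 1 - p) =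
          (1 + Real.exp x) ^ β * (1 + Real.exp x) ^ (q - p + 1) := by
        rw [← Real.rpow_add hy]
        ring_nf
      rw [e, show -(q - p) - 1 = p - q - 1 by ring]
      ring

lemma continuousOn_integral_kernel {κ W : ℝ → ℂ} {b : ℝ → ℝ} (hκ : Continuous κ)
    (hW : AEStronglyMeasurable W (volume.restrict (Ioi 0))) (hb : IntegrableOn b (Ioi 0))
    (hbd : ∀ s r : ℝ, 0 < r → r < s → ‖κ (s - r) * W s‖ ≤ b s) :
    ContinuousOn (fun r => ∫ s in Ioi r, κ (s - r) * W s) (Ioi 0) := by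
  intro r hr
  rw [mem_Ioi] at hr
  refine ContinuousAt.continuousWithinAt ?_
  have heq : ∀ᶠ u in 𝓝 r, ∫ s in Ioi u, κ (s - u) * W s =
      ∫ s in Ioi 0, (Ioi u).indicator (fun s => κ (s - u) * W s) s := by
    filter_upwards [lt_mem_nhds hr] with u hu
    rw [setIntegral_indicator measurableSet_Ioi, inter_eq_self_of_subset_right
      (Ioi_subset_Ioi hu.le)]
  refine ContinuousAt.congr ?_ (heq.mono fun _ h => h.symm)
  refine continuousAt_of_dominated (bound := fun s => |b s|) ?_ ?_ hb.abs ?_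
  · refine Eventually.of_forall fun u => AEStronglyMeasurable.indicator ?_ measurableSet_Ioi
    exact (by fun_prop : Continuous fun s => κ (s - u)).aestronglyMeasurable.mul hW
  · filter_upwards [lt_mem_nhds hr] with u hu
    refine Eventually.of_forall fun s => ?_
    by_cases h : s ∈ Ioi u
    · rw [indicator_of_mem h]
      exact (hbd s u hu h).trans (le_abs_self _)
    · rw [indicator_of_notMem h]
      simp
  · have hne : ∀ᵐ s ∂(volume.restrict (Ioi (0 : ℝ))), s ≠ r :=
      ae_restrict_of_ae (Measure.ae_ne volume r)
    filter_upwards [hne] with s hs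
    rcases lt_or_gt_of_ne hs with h | h
    · refine ContinuousAt.congr (f := fun _ => (0 : ℂ)) continuousAt_const ?_
      filter_upwards [lt_mem_nhds h] with u hu
      rw [indicator_of_notMem]
      simpa using hu.le
    · refine ContinuousAt.congr (f := fun u => κ (s - u) * W s) (by fun_prop) ?_
      filter_upwards [gt_mem_nhds h] with u hu
      rw [indicator_of_mem]
      simpa using hu

lemma continuous_volterra {κ w φ : ℝ → ℂ} {B q C p N β : ℝ} (hκ : Grows κ B q)
    (hw : Decays w C p) (hφc : Continuous φ) (hφ : ∀ x, ‖φ x‖ ≤ N) (hpq : q + 1 < p) :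
    Continuous (volterra β κ w φ) := by
  have hy : ∀ x, 1 + Real.exp x ≠ 0 := fun x => by positivity
  unfold volterra
  refine Continuous.mul (Complex.continuous_ofReal.comp
    ((continuous_const.add Real.continuous_exp).rpow_const fun x => Or.inl (hy x))) ?_
  have h := continuousOn_integral_kernel (W := fun s => w s * φ (Real.log s))
    (b := fun s => B * C * N * (1 + s) ^ (q - p)) hκ.1
    (hw.1.mul (hφc.measurable.comp Real.measurable_log).aestronglyMeasurable)
    ((integrableOn_one_add_rpow (by linarith) le_rfl).const_mul _)
    (fun s r hr hs => by
      rw [← mul_assoc]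
      exact norm_kernel_mul_le hκ hw hφ hr.le hs)
  simpa only [mul_assoc, Function.comp_def] using
    h.comp_continuous Real.continuous_exp fun x => Real.exp_pos x

lemma exists_volterra_clm {κ w : ℝ → ℂ} {B q C p β : ℝ} (hκ : Grows κ B q)
    (hw : Decays w C p) (hpq : q + 1 < p) (hβ : β + q + 1 ≤ p) :
    ∃ K : (ℝ →ᵇ ℂ) →L[ℝ] (ℝ →ᵇ ℂ), (∀ φ x, K φ x = volterra β κ w φ x) ∧
      ‖K‖ ≤ B * C / (p - q - 1) := by
  have hB := hκ.2.1
  have hC := hw.2.1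
  have hden : 0 < p - q - 1 := by linarith
  have hbd : ∀ (φ : ℝ →ᵇ ℂ) x, ‖volterra β κ w φ x‖ ≤ B * C / (p - q - 1) * ‖φ‖ := by
    intro φ x
    refine (norm_volterra_le hκ hw φ.norm_coe_le_norm hpq x).trans ?_
    have hy : (1 + Real.exp x) ^ (β + q + 1 - p) ≤ 1 :=
      Real.rpow_le_one_of_one_le_of_nonpos (by linarith [Real.exp_pos x]) (by linarith)
    have : B * C / (p - q - 1) * (1 + Real.exp x) ^ (β + q + 1 - p) ≤ B * C / (p - q - 1) * 1 := by
      gcongr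
    rw [mul_one] at this
    gcongr
  have hint : ∀ (φ : ℝ →ᵇ ℂ) (x : ℝ), IntegrableOn
      (fun s => κ (s - Real.exp x) * w s * φ (Real.log s)) (Ioi (Real.exp x)) := fun φ x =>
    integrableOn_kernel_mul hκ hw φ.continuous φ.norm_coe_le_norm hpq (Real.exp_pos x).le
  let L : (ℝ →ᵇ ℂ) →ₗ[ℝ] (ℝ →ᵇ ℂ) :=
    { toFun := fun φ => BoundedContinuousFunction.ofNormedAddCommGroup (volterra β κ w φ)
        (continuous_volterra hκ hw φ.continuous φ.norm_coe_le_norm hpq) _ (hbd φ)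
      map_add' := by
        intro φ ψ
        ext x
        simp only [BoundedContinuousFunction.coe_ofNormedAddCommGroup,
          BoundedContinuousFunction.coe_add, Pi.add_apply, volterra, mul_add]
        rw [integral_add (hint φ x) (hint ψ x), mul_add]
      map_smul' := by
        intro c φ
        ext x
        simp only [BoundedContinuousFunction.coe_ofNormedAddCommGroup,
          BoundedContinuousFunction.coe_smul, volterra, RingHom.id_apply,
          mul_smul_comm, integral_smul] }
  refine ⟨L.mkContinuous (B * C / (p - q - 1)) fun φ => ?_, fun φ x => rfl, ?_⟩
  · exact (BoundedContinuousFunction.norm_le (by positivity)).2 (hbd φ)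
  · exact LinearMap.mkContinuous_norm_le _ (by positivity) _

/-! ### The oscillatory kernels and their dependence on `ρ` -/

/-- The `j`-th `ρ`-derivative of `exp (2 i ρ t)`. -/
def osc (j : ℕ) (ρ t : ℝ) : ℂ :=
  (2 * Complex.I * t) ^ j * Complex.exp (2 * Complex.I * ρ * t)

lemma continuous_osc (j : ℕ) (ρ : ℝ) : Continuous (osc j ρ) := by
  unfold osc
  fun_prop

lemma norm_exp_osc (ρ t : ℝ) : ‖Complex.exp (2 * Complex.I * ρ * t)‖ = 1 := by
  rw [show 2 * Complex.I * (ρ : ℂ) * t = ((2 * ρ * t : ℝ) : ℂ) * Complex.I by push_cast; ring]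
  exact Complex.norm_exp_ofReal_mul_I _

lemma norm_osc (j : ℕ) (ρ t : ℝ) : ‖osc j ρ t‖ = 2 ^ j * |t| ^ j := by
  rw [osc, norm_mul, norm_exp_osc, mul_one, norm_pow, norm_mul, norm_mul, Complex.norm_I,
    Complex.norm_real, Real.norm_eq_abs, mul_pow]
  simp

lemma grows_osc (j : ℕ) (ρ : ℝ) : Grows (osc j ρ) (2 ^ j) j :=
  ⟨continuous_osc j ρ, by positivity, by positivity, fun t ht => by
    rw [norm_osc, abs_of_nonneg ht, Real.rpow_natCast]⟩

lemma norm_exp_sub_one_sub_le (θ : ℝ) :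
    ‖Complex.exp (θ * Complex.I) - 1 - θ * Complex.I‖ ≤ 3 * |θ| ^ (3 / 2 : ℝ) := by
  have hn : ‖(θ : ℂ) * Complex.I‖ = |θ| := by simp
  have h0 := abs_nonneg θ
  rcases le_total |θ| 1 with h | h
  · refine (Complex.norm_exp_sub_one_sub_id_le (by rwa [hn])).trans ?_
    rw [hn, ← Real.rpow_two]
    have := Real.rpow_le_rpow_of_exponent_ge' h0 h (by norm_num : (0 : ℝ) ≤ 3 / 2)
      (by norm_num : (3 / 2 : ℝ) ≤ 2)
    have h3 : 0 ≤ |θ| ^ (3 / 2 : ℝ) := by positivity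
    linarith
  · have h1 : ‖Complex.exp (θ * Complex.I) - 1 - θ * Complex.I‖ ≤ 1 + 1 + |θ| := by
      refine (norm_sub_le _ _).trans ?_
      rw [hn]
      gcongr
      refine (norm_sub_le _ _).trans ?_
      rw [Complex.norm_exp_ofReal_mul_I, norm_one]
    have h2 : |θ| ≤ |θ| ^ (3 / 2 : ℝ) := by
      simpa using Real.rpow_le_rpow_of_exponent_le h (by norm_num : (1 : ℝ) ≤ 3 / 2)
    linarith

lemma grows_osc_remainder (j : ℕ) (ρ ρ' : ℝ) :
    Grows (fun t => osc j ρ' t - osc j ρ t - (ρ' - ρ) * osc (j + 1) ρ t)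
      (2 ^ j * 3 * (2 * |ρ' - ρ|) ^ (3 / 2 : ℝ)) (j + 3 / 2) := by
  refine ⟨?_, by positivity, by positivity, fun t ht => ?_⟩
  · have := continuous_osc
    fun_prop
  · have key : osc j ρ' t - osc j ρ t - (ρ' - ρ) * osc (j + 1) ρ t = osc j ρ t *
        (Complex.exp ((2 * (ρ' - ρ) * t : ℝ) * Complex.I) - 1 -
          (2 * (ρ' - ρ) * t : ℝ) * Complex.I) := by
      have e : Complex.exp (2 * Complex.I * ρ' * t) = Complex.exp (2 * Complex.I * ρ * t) *
          Complex.exp ((2 * (ρ' - ρ) * t : ℝ) * Complex.I) := by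
        rw [← Complex.exp_add]
        congr 1
        push_cast
        ring
      simp only [osc, e]
      push_cast
      ring
    beta_reduce
    rw [key, norm_mul, norm_osc, abs_of_nonneg ht]
    have h := norm_exp_sub_one_sub_le (2 * (ρ' - ρ) * t)
    rw [abs_mul, abs_mul, abs_two, abs_of_nonneg ht,
      Real.mul_rpow (by positivity) ht] at h
    rw [Real.rpow_add' ht (by positivity), Real.rpow_natCast]
    calc _ ≤ 2 ^ j * t ^ j * (3 * ((2 * |ρ' - ρ|) ^ (3 / 2 : ℝ) * t ^ (3 / 2 : ℝ))) := by gcongr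
      _ = _ := by ring

open Classical in
/-- The Volterra operator with kernel `osc j ρ`, acting on bounded continuous functions. -/
def oscOp (w : ℝ → ℂ) (β : ℝ) (j : ℕ) (ρ : ℝ) : (ℝ →ᵇ ℂ) →L[ℝ] (ℝ →ᵇ ℂ) :=
  if h : ∃ K : (ℝ →ᵇ ℂ) →L[ℝ] (ℝ →ᵇ ℂ), ∀ φ x, K φ x = volterra β (osc j ρ) w φ x
  then h.choose else 0

section oscOp

variable {w : ℝ → ℂ} {C p β : ℝ} {j : ℕ}

lemma oscOp_apply (hw : Decays w C p) (hj : j + 1 < p) (hβ : β + j + 1 ≤ p) (ρ : ℝ)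
    (φ : ℝ →ᵇ ℂ) (x : ℝ) : oscOp w β j ρ φ x = volterra β (osc j ρ) w φ x := by
  have h : ∃ K : (ℝ →ᵇ ℂ) →L[ℝ] (ℝ →ᵇ ℂ), ∀ φ x, K φ x = volterra β (osc j ρ) w φ x :=
    (exists_volterra_clm (grows_osc j ρ) hw hj hβ).imp fun _ h => h.1
  rw [oscOp, dif_pos h]
  exact h.choose_spec φ x

lemma norm_oscOp_le (hw : Decays w C p) (hj : j + 1 < p) (hβ : β + j + 1 ≤ p) (ρ : ℝ) :
    ‖oscOp w β j ρ‖ ≤ 2 ^ j * C / (p - j - 1) := by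
  obtain ⟨K, hK, hn⟩ := exists_volterra_clm (grows_osc j ρ) hw hj hβ
  have : oscOp w β j ρ = K := by
    ext φ x
    rw [oscOp_apply hw hj hβ, hK]
  rwa [this]

lemma norm_oscOp_apply_le (hw : Decays w C p) (hj : j + 1 < p) (hβ : β + j + 1 ≤ p) (ρ : ℝ)
    (φ : ℝ →ᵇ ℂ) (x : ℝ) : ‖oscOp w β j ρ φ x‖ ≤
      2 ^ j * C / (p - j - 1) * (1 + Real.exp x) ^ (β + j + 1 - p) * ‖φ‖ := by
  rw [oscOp_apply hw hj hβ]
  exact norm_volterra_le (grows_osc j ρ) hw φ.norm_coe_le_norm hj x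

lemma norm_oscOp_remainder_le (hw : Decays w C p) (hj : j + 5 / 2 < p) (hβ : β + j + 5 / 2 ≤ p)
    (ρ ρ' : ℝ) :
    ‖oscOp w β j ρ' - oscOp w β j ρ - (ρ' - ρ) • oscOp w β (j + 1) ρ‖ ≤
      2 ^ j * 3 * (2 * |ρ' - ρ|) ^ (3 / 2 : ℝ) * C / (p - (j + 3 / 2) - 1) := by
  obtain ⟨K, hK, hn⟩ := exists_volterra_clm (β := β) (grows_osc_remainder j ρ ρ') hw
    (by linarith) (by linarith)
  have hj1 : ((j + 1 : ℕ) : ℝ) + 1 < p := by push_cast; linarith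
  have : oscOp w β j ρ' - oscOp w β j ρ - (ρ' - ρ) • oscOp w β (j + 1) ρ = K := by
    ext φ x
    have hint : ∀ (i : ℕ) (σ : ℝ), (i : ℝ) + 1 < p → IntegrableOn
        (fun s => osc i σ (s - Real.exp x) * w s * φ (Real.log s)) (Ioi (Real.exp x)) :=
      fun i σ hi => integrableOn_kernel_mul (grows_osc i σ) hw φ.continuous φ.norm_coe_le_norm hi
        (Real.exp_pos x).le
    have h1 := hint j ρ' (by linarith)
    have h2 := hint j ρ (by linarith)
    have h12 : IntegrableOn (fun s => osc j ρ' (s - Real.exp x) * w s * φ (Real.log s) -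
        osc j ρ (s - Real.exp x) * w s * φ (Real.log s)) (Ioi (Real.exp x)) := h1.sub h2
    have h3 := (hint (j + 1) ρ hj1).const_mul ((ρ' : ℂ) - ρ)
    change oscOp w β j ρ' φ x - oscOp w β j ρ φ x - (ρ' - ρ) • oscOp w β (j + 1) ρ φ x = K φ x
    rw [hK, oscOp_apply hw (by linarith) (by linarith), oscOp_apply hw (by linarith) (by linarith),
      oscOp_apply hw hj1 (by push_cast; linarith)]
    have e : ∫ s in Ioi (Real.exp x), (osc j ρ' (s - Real.exp x) - osc j ρ (s - Real.exp x) -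
        (ρ' - ρ) * osc (j + 1) ρ (s - Real.exp x)) * w s * φ (Real.log s) =
        (∫ s in Ioi (Real.exp x), osc j ρ' (s - Real.exp x) * w s * φ (Real.log s)) -
        (∫ s in Ioi (Real.exp x), osc j ρ (s - Real.exp x) * w s * φ (Real.log s)) -
        (ρ' - ρ) * ∫ s in Ioi (Real.exp x),
          osc (j + 1) ρ (s - Real.exp x) * w s * φ (Real.log s) := by
      rw [← integral_const_mul, ← integral_sub h1 h2, ← integral_sub h12 h3]
      congr 1
      ext s
      ring
    simp only [volterra, e, Complex.real_smul]
    push_cast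
    ring
  rwa [this]

lemma hasDerivAt_oscOp (hw : Decays w C p) (hj : j + 5 / 2 < p) (hβ : β + j + 5 / 2 ≤ p)
    (ρ : ℝ) : HasDerivAt (oscOp w β j) (oscOp w β (j + 1) ρ) ρ := by
  refine (hasDerivAt_iff_isLittleO (𝕜 := ℝ) (F := (ℝ →ᵇ ℂ) →L[ℝ] (ℝ →ᵇ ℂ))).2 ?_
  have hO : (fun ρ' => oscOp w β j ρ' - oscOp w β j ρ - (ρ' - ρ) • oscOp w β (j + 1) ρ)
      =O[𝓝 ρ] fun ρ' => |ρ' - ρ| ^ (3 / 2 : ℝ) := by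
    refine Asymptotics.IsBigO.of_bound
      (2 ^ j * 3 * (2 : ℝ) ^ (3 / 2 : ℝ) * C / (p - (j + 3 / 2) - 1)) (Eventually.of_forall ?_)
    intro ρ'
    refine (norm_oscOp_remainder_le hw hj hβ ρ ρ').trans (le_of_eq ?_)
    rw [Real.mul_rpow zero_le_two (abs_nonneg _), Real.norm_of_nonneg (by positivity)]
    ring
  refine hO.trans_isLittleO ?_
  rw [Asymptotics.isLittleO_iff]
  intro c hc
  have ht : Tendsto (fun ρ' : ℝ => |ρ' - ρ| ^ (1 / 2 : ℝ)) (𝓝 ρ) (𝓝 0) := by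
    have : Continuous fun ρ' : ℝ => |ρ' - ρ| ^ (1 / 2 : ℝ) :=
      (by fun_prop : Continuous fun ρ' : ℝ => |ρ' - ρ|).rpow_const fun _ => Or.inr (by norm_num)
    simpa using this.tendsto ρ
  filter_upwards [ht.eventually (gt_mem_nhds hc)] with ρ' h
  rw [Real.norm_of_nonneg (by positivity), Real.norm_eq_abs,
    show (3 / 2 : ℝ) = 1 / 2 + 1 by norm_num,
    Real.rpow_add' (abs_nonneg _) (by norm_num), Real.rpow_one]
  gcongr

end oscOp

/-! ### A priori integrability of solutions of the Volterra equation -/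

/-- `m` solves the Volterra equation with potential `v` at frequency `ρ`. -/
def Solves (v : ℝ → ℂ) (ρ : ℝ) (m : ℝ → ℂ) : Prop :=
  ∀ r : ℝ, 0 ≤ r → m r = 1 + ∫ s in Ioi r,
    ((Complex.exp (2 * Complex.I * (ρ : ℂ) * ((s - r : ℝ) : ℂ)) - 1) /
      (2 * Complex.I * (ρ : ℂ))) * v s * m s

section Integrability

variable {v m : ℝ → ℂ} {ρ : ℝ}

lemma norm_volterra_kernel_le (hρ : 0 < ρ) (t : ℝ) :
    ‖(Complex.exp (2 * Complex.I * (ρ : ℂ) * (t : ℂ)) - 1) / (2 * Complex.I * (ρ : ℂ))‖ ≤ ρ⁻¹ := by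
  have h1 : ‖Complex.exp (2 * Complex.I * (ρ : ℂ) * (t : ℂ)) - 1‖ ≤ 2 := by
    refine (norm_sub_le _ _).trans ?_
    rw [norm_exp_osc, norm_one]
    norm_num
  have h2 : ‖2 * Complex.I * (ρ : ℂ)‖ = 2 * ρ := by
    simp [abs_of_pos hρ]
  rw [norm_div, h2, div_le_iff₀ (by positivity)]
  field_simp
  linarith

lemma two_I_mul_ne_zero (hρ : 0 < ρ) : 2 * Complex.I * (ρ : ℂ) ≠ 0 := by
  have : (ρ : ℂ) ≠ 0 := by exact_mod_cast hρ.ne'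
  simp [this]

/-- Integrability of the integrand at two base points which are not congruent modulo the period
of the kernel forces integrability of `v * m`. -/
lemma integrableOn_of_two_base_points (hρ : 0 < ρ) {a b s : ℝ} (ha : a ≤ s) (hb : b ≤ s)
    (hab : Complex.exp (2 * Complex.I * ρ * a) ≠ Complex.exp (2 * Complex.I * ρ * b))
    (hia : IntegrableOn (fun u => ((Complex.exp (2 * Complex.I * (ρ : ℂ) * ((u - a : ℝ) : ℂ)) - 1) /
      (2 * Complex.I * (ρ : ℂ))) * v u * m u) (Ioi a))
    (hib : IntegrableOn (fun u => ((Complex.exp (2 * Complex.I * (ρ : ℂ) * ((u - b : ℝ) : ℂ)) - 1) /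
      (2 * Complex.I * (ρ : ℂ))) * v u * m u) (Ioi b)) :
    IntegrableOn (fun u => v u * m u) (Ioi s) := by
  have h0 := two_I_mul_ne_zero hρ
  have hρ' : (ρ : ℂ) ≠ 0 := by exact_mod_cast hρ.ne'
  have hsub := sub_ne_zero.2 hab.symm
  have h := (((hia.mono_set (Ioi_subset_Ioi ha)).const_mul
    (Complex.exp (2 * Complex.I * ρ * a))).sub ((hib.mono_set (Ioi_subset_Ioi hb)).const_mul
    (Complex.exp (2 * Complex.I * ρ * b)))).const_mul ((2 * Complex.I * (ρ : ℂ)) /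
      (Complex.exp (2 * Complex.I * ρ * b) - Complex.exp (2 * Complex.I * ρ * a)))
  refine Integrable.congr h (Eventually.of_forall fun u => ?_)
  have key : ∀ c : ℝ, Complex.exp (2 * Complex.I * (ρ : ℂ) * ((u - c : ℝ) : ℂ)) =
      Complex.exp (2 * Complex.I * ρ * u) / Complex.exp (2 * Complex.I * ρ * c) := by
    intro c
    rw [← Complex.exp_sub]
    congr 1
    push_cast
    ring
  have ea := Complex.exp_ne_zero (2 * Complex.I * ρ * a)
  have eb := Complex.exp_ne_zero (2 * Complex.I * ρ * b)
  simp only [key, Pi.sub_apply]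
  field_simp
  ring

lemma countable_setOf_exp_eq (hρ : 0 < ρ) (a : ℝ) :
    {r : ℝ | Complex.exp (2 * Complex.I * ρ * r) =
      Complex.exp (2 * Complex.I * ρ * a)}.Countable := by
  refine (countable_range fun n : ℤ => a + n * (Real.pi / ρ)).mono fun r hr => ?_
  obtain ⟨n, hn⟩ := Complex.exp_eq_exp_iff_exists_int.1 hr
  refine ⟨n, ?_⟩
  have h0 := two_I_mul_ne_zero hρ
  have hρ' : (ρ : ℂ) ≠ 0 := by exact_mod_cast hρ.ne'
  have : (r : ℂ) = ((a + n * (Real.pi / ρ) : ℝ) : ℂ) := by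
    refine mul_left_cancel₀ h0 (hn.trans ?_)
    push_cast
    field_simp
  exact_mod_cast this.symm

lemma Solves.integrableOn_or_ae_eq_one (hm : Solves v ρ m) (hρ : 0 < ρ) (s : ℝ) :
    IntegrableOn (fun u => v u * m u) (Ioi s) ∨ ∀ᵐ r, r ∈ Ioc 0 s → m r = 1 := by
  set A : Set ℝ := {a | IntegrableOn (fun u =>
    ((Complex.exp (2 * Complex.I * (ρ : ℂ) * ((u - a : ℝ) : ℂ)) - 1) /
      (2 * Complex.I * (ρ : ℂ))) * v u * m u) (Ioi a)} with hA
  by_cases h : ∃ a ∈ A ∩ Ioc 0 s, ∃ b ∈ A ∩ Ioc 0 s,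
      Complex.exp (2 * Complex.I * ρ * a) ≠ Complex.exp (2 * Complex.I * ρ * b)
  · obtain ⟨a, ⟨ha, has⟩, b, ⟨hb, hbs⟩, hab⟩ := h
    exact Or.inl (integrableOn_of_two_base_points hρ has.2 hbs.2 hab ha hb)
  · right
    push Not at h
    have hc : (A ∩ Ioc 0 s).Countable := by
      rcases (A ∩ Ioc 0 s).eq_empty_or_nonempty with he | ⟨a, ha⟩
      · simp [he]
      · exact (countable_setOf_exp_eq hρ a).mono fun b hb => h b hb a ha
    filter_upwards [hc.ae_notMem volume] with r hr hrs
    rw [hm r hrs.1.le, integral_undef, add_zero]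
    exact fun hi => hr ⟨hi, hrs⟩

lemma Solves.norm_le (hm : Solves v ρ m) (hρ : 0 < ρ) {s r : ℝ} (hr : 0 ≤ r) (hsr : s ≤ r)
    (hf : IntegrableOn (fun u => v u * m u) (Ioi s)) :
    ‖m r‖ ≤ 1 + ρ⁻¹ * ∫ u in Ioi s, ‖v u * m u‖ := by
  rw [hm r hr]
  refine (norm_add_le _ _).trans ?_
  rw [norm_one]
  gcongr
  have h1 : ‖∫ u in Ioi r, ((Complex.exp (2 * Complex.I * (ρ : ℂ) * ((u - r : ℝ) : ℂ)) - 1) /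
      (2 * Complex.I * (ρ : ℂ))) * v u * m u‖ ≤ ∫ u in Ioi r, ρ⁻¹ * ‖v u * m u‖ := by
    refine norm_integral_le_of_norm_le
      ((hf.mono_set (Ioi_subset_Ioi hsr)).norm.const_mul _) (Eventually.of_forall fun u => ?_)
    rw [mul_assoc, norm_mul]
    gcongr
    exact norm_volterra_kernel_le hρ _
  rw [integral_const_mul] at h1
  refine h1.trans (mul_le_mul_of_nonneg_left ?_ (by positivity))
  exact setIntegral_mono_set hf.norm (Eventually.of_forall fun _ => norm_nonneg _)
    (Ioi_subset_Ioi hsr).eventuallyLE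

lemma Solves.norm_le_two_of_integrableOn (hm : Solves v ρ m) (hρ : 0 < ρ)
    (hv : IntegrableOn v (Ioi 0)) (hK : 2 * ∫ u in Ioi 0, ‖v u‖ ≤ ρ) {s r : ℝ} (hs : 0 ≤ s)
    (hsr : s ≤ r) (hf : IntegrableOn (fun u => v u * m u) (Ioi s)) : ‖m r‖ ≤ 2 := by
  set M := ∫ u in Ioi s, ‖v u * m u‖ with hM
  set K := ∫ u in Ioi 0, ‖v u‖ with hKdef
  have hvs : IntegrableOn v (Ioi s) := hv.mono_set (Ioi_subset_Ioi hs)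
  have hM0 : 0 ≤ M := integral_nonneg fun _ => norm_nonneg _
  have h1 : M ≤ ∫ u in Ioi s, ‖v u‖ * (1 + ρ⁻¹ * M) := by
    refine setIntegral_mono_on hf.norm (hvs.norm.mul_const _) measurableSet_Ioi fun u hu => ?_
    rw [norm_mul]
    gcongr
    exact hm.norm_le hρ (hs.trans (le_of_lt hu)) (le_of_lt hu) hf
  have h2 : ∫ u in Ioi s, ‖v u‖ ≤ K :=
    setIntegral_mono_set hv.norm (Eventually.of_forall fun _ => norm_nonneg _)
      (Ioi_subset_Ioi hs).eventuallyLE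
  rw [integral_mul_const] at h1
  have h3 : M ≤ K * (1 + ρ⁻¹ * M) := h1.trans (by gcongr)
  have h4 : K * ρ⁻¹ ≤ 1 / 2 := by
    rw [← div_eq_mul_inv, div_le_iff₀ hρ]
    linarith
  have h5 : M ≤ 2 * K := by nlinarith
  have h6 : ρ⁻¹ * M ≤ 1 := by
    have : 0 ≤ ρ⁻¹ := by positivity
    calc ρ⁻¹ * M ≤ ρ⁻¹ * (2 * K) := by gcongr
      _ ≤ 1 := by linarith
  exact (hm.norm_le hρ (hs.trans hsr) hsr hf).trans (by linarith)

lemma Solves.integrableOn (hm : Solves v ρ m) (hρ : 0 < ρ)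
    (hv : IntegrableOn v (Ioi 0)) (hK : 2 * ∫ u in Ioi 0, ‖v u‖ ≤ ρ) :
    IntegrableOn (fun u => v u * m u) (Ioi 0) := by
  classical
  set f : ℝ → ℂ := fun u => v u * m u with hf
  set D : {q : ℚ // 0 ≤ q} → Set ℝ := fun q =>
    if IntegrableOn f (Ioi (q : ℝ)) then Ioi (q : ℝ) else Ioc 0 (q : ℝ) with hD
  have hq0 : ∀ q : {q : ℚ // 0 ≤ q}, (0 : ℝ) ≤ ((q : ℚ) : ℝ) := fun q => by exact_mod_cast q.2
  have hsub : ∀ q, D q ⊆ Ioi 0 := by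
    intro q
    simp only [hD]
    split_ifs
    · exact Ioi_subset_Ioi (hq0 q)
    · exact Ioc_subset_Ioi_self
  have hpiece : ∀ q, AEStronglyMeasurable f (volume.restrict (D q)) ∧
      ∀ᵐ u ∂volume.restrict (D q), ‖f u‖ ≤ 2 * ‖v u‖ := by
    intro q
    have hvq := (hv.mono_set (hsub q)).aestronglyMeasurable
    simp only [hD] at hvq ⊢
    split_ifs at hvq ⊢ with h
    · refine ⟨h.aestronglyMeasurable, ?_⟩
      filter_upwards [ae_restrict_mem measurableSet_Ioi] with u hu
      rw [hf, norm_mul, mul_comm]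
      gcongr
      exact hm.norm_le_two_of_integrableOn hρ hv hK (hq0 q) (le_of_lt hu) h
    · have h1 := (hm.integrableOn_or_ae_eq_one hρ _).resolve_left h
      have h2 : ∀ᵐ u ∂volume.restrict (Ioc 0 ((q : ℚ) : ℝ)), m u = 1 :=
        (ae_restrict_iff' measurableSet_Ioc).2 h1
      refine ⟨hvq.congr ?_, ?_⟩
      · filter_upwards [h2] with u hu
        simp [hf, hu]
      · filter_upwards [h2] with u hu
        simp only [hf, hu, mul_one]
        linarith [norm_nonneg (v u)]
  have hcover : (Ioi 0 \ ⋃ q, D q).Subsingleton := by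
    have key : ∀ x y : ℝ, x ∈ Ioi 0 \ ⋃ q, D q → y ∈ Ioi 0 \ ⋃ q, D q → ¬ x < y := by
      intro x y hx hy hxy
      obtain ⟨q, hxq, hqy⟩ := exists_rat_btwn hxy
      have hq : 0 ≤ q := by exact_mod_cast (lt_trans hx.1 hxq).le
      have hxD : x ∉ D ⟨q, hq⟩ := fun h => hx.2 (mem_iUnion.2 ⟨_, h⟩)
      have hyD : y ∉ D ⟨q, hq⟩ := fun h => hy.2 (mem_iUnion.2 ⟨_, h⟩)
      simp only [hD] at hxD hyD
      split_ifs at hxD hyD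
      · exact hyD hqy
      · exact hxD ⟨hx.1, hxq.le⟩
    intro x hx y hy
    exact le_antisymm (not_lt.1 (key y x hy hx)) (not_lt.1 (key x y hx hy))
  have hae : (Ioi (0 : ℝ)) =ᵐ[volume] ⋃ q, D q := by
    refine (ae_le_set.2 (hcover.measure_zero volume) |>.antisymm ?_)
    exact (iUnion_subset hsub).eventuallyLE
  rw [IntegrableOn, Measure.restrict_congr_set hae]
  refine Integrable.mono' (g := fun u => 2 * ‖v u‖) ?_
    (AEStronglyMeasurable.iUnion fun q => (hpiece q).1)
    ((ae_restrict_iUnion_iff _ _).2 fun q => (hpiece q).2)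
  exact (hv.mono_set (iUnion_subset hsub)).norm.const_mul 2

end Integrability

/-! ### The first-order system satisfied by a solution and its derivative -/

lemma hasDerivAt_integral_Ioi {g : ℝ → ℂ} (hg : IntegrableOn g (Ioi 0))
    (hc : ContinuousOn g (Ioi 0)) {r : ℝ} (hr : 0 < r) :
    HasDerivAt (fun u => ∫ s in Ioi u, g s) (-g r) r := by
  have hi : ∀ u, 0 < u → IntegrableOn g (Ioi u) := fun u hu => hg.mono_set (Ioi_subset_Ioi hu.le)
  have hcr : ContinuousAt g r := hc.continuousAt (Ioi_mem_nhds hr)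
  have hd : HasDerivAt (fun u => ∫ s in r..u, g s) (g r) r :=
    intervalIntegral.integral_hasDerivAt_right (by simp)
      (hc.stronglyMeasurableAtFilter isOpen_Ioi r hr) hcr
  have := (hd.const_sub (∫ s in Ioi r, g s))
  refine this.congr_of_eventuallyEq ?_
  filter_upwards [lt_mem_nhds hr] with u hu
  rw [← intervalIntegral.integral_interval_add_Ioi (hi r hr) (hi u hu)]
  ring

/-- The `r`-derivative of a solution `m` of the Volterra equation. -/
def solDeriv (v : ℝ → ℂ) (ρ : ℝ) (m : ℝ → ℂ) (r : ℝ) : ℂ :=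
  -∫ s in Ioi r, osc 0 ρ (s - r) * (v s * m s)

section System

variable {v v' m : ℝ → ℂ} {ρ C : ℝ}

lemma osc_zero (ρ t : ℝ) : osc 0 ρ t = Complex.exp (2 * Complex.I * ρ * t) := by
  simp [osc]

lemma norm_osc_zero (ρ t : ℝ) : ‖osc 0 ρ t‖ = 1 := by
  rw [osc_zero, norm_exp_osc]

lemma osc_zero_sub (ρ s r : ℝ) : osc 0 ρ (s - r) = osc 0 ρ (-r) * osc 0 ρ s := by
  rw [osc_zero, osc_zero, osc_zero, ← Complex.exp_add]
  congr 1
  push_cast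
  ring

lemma osc_zero_neg_mul_self (ρ r : ℝ) : osc 0 ρ (-r) * osc 0 ρ r = 1 := by
  rw [← osc_zero_sub, sub_self, osc_zero]
  simp

lemma hasDerivAt_osc_zero (ρ r : ℝ) :
    HasDerivAt (osc 0 ρ) (2 * Complex.I * ρ * osc 0 ρ r) r := by
  have h : HasDerivAt (fun t : ℝ => Complex.exp (2 * Complex.I * ρ * t))
      (Complex.exp (2 * Complex.I * ρ * r) * (2 * Complex.I * ρ * 1)) r :=
    (((hasDerivAt_id r).ofReal_comp).const_mul (2 * Complex.I * (ρ : ℂ))).cexp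
  have e : osc 0 ρ = fun t : ℝ => Complex.exp (2 * Complex.I * ρ * t) := funext (osc_zero ρ)
  rw [e]
  exact h.congr_deriv (by ring)

lemma integrableOn_osc_mul {f : ℝ → ℂ} {r : ℝ} (hf : IntegrableOn f (Ioi r)) (ρ a : ℝ) :
    IntegrableOn (fun s => osc 0 ρ (s - a) * f s) (Ioi r) := by
  refine hf.norm.mono' (((continuous_osc 0 ρ).comp
    (continuous_id.sub continuous_const)).aestronglyMeasurable.mul hf.aestronglyMeasurable) ?_
  refine Eventually.of_forall fun s => ?_
  rw [norm_mul, norm_osc_zero, one_mul]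

lemma Solves.sub_one_eq (hm : Solves v ρ m) (hρ : 0 < ρ)
    (hf : IntegrableOn (fun u => v u * m u) (Ioi 0)) {r : ℝ} (hr : 0 ≤ r) :
    2 * Complex.I * ρ * (m r - 1) = -solDeriv v ρ m r - ∫ s in Ioi r, v s * m s := by
  have h0 := two_I_mul_ne_zero hρ
  have hρ' : (ρ : ℂ) ≠ 0 := by exact_mod_cast hρ.ne'
  have hfr := hf.mono_set (Ioi_subset_Ioi hr)
  rw [hm r hr, add_sub_cancel_left, solDeriv, neg_neg,
    ← integral_sub (integrableOn_osc_mul hfr ρ r) hfr, ← integral_const_mul]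
  congr 1
  ext s
  rw [osc_zero]
  field_simp

lemma Solves.continuousOn_solDeriv (hf : IntegrableOn (fun u => v u * m u) (Ioi 0)) :
    ContinuousOn (solDeriv v ρ m) (Ioi 0) :=
  (continuousOn_integral_kernel (b := fun s => ‖v s * m s‖) (continuous_osc 0 ρ)
    hf.aestronglyMeasurable hf.norm fun s r _ _ => by
      rw [norm_mul, norm_osc_zero, one_mul]).neg

lemma Solves.continuousOn (hm : Solves v ρ m) (hρ : 0 < ρ)
    (hf : IntegrableOn (fun u => v u * m u) (Ioi 0)) : ContinuousOn m (Ioi 0) := by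
  have h0 := two_I_mul_ne_zero hρ
  have hρ' : (ρ : ℂ) ≠ 0 := by exact_mod_cast hρ.ne'
  have h1 : ContinuousOn (fun r => ∫ s in Ioi r, v s * m s) (Ioi 0) := by
    simpa using continuousOn_integral_kernel (κ := fun _ => 1) (b := fun s => ‖v s * m s‖)
      continuous_const hf.aestronglyMeasurable hf.norm (by simp)
  have h2 : ContinuousOn (fun r => 1 + (2 * Complex.I * (ρ : ℂ))⁻¹ *
      (-solDeriv v ρ m r - ∫ s in Ioi r, v s * m s)) (Ioi 0) :=
    continuousOn_const.add (continuousOn_const.mul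
      ((Solves.continuousOn_solDeriv hf).neg.sub h1))
  refine h2.congr fun r hr => ?_
  beta_reduce
  rw [← hm.sub_one_eq hρ hf (le_of_lt hr)]
  field_simp
  ring

lemma Solves.hasDerivAt (hm : Solves v ρ m) (hρ : 0 < ρ) (hv : ContinuousOn v (Ioi 0))
    (hf : IntegrableOn (fun u => v u * m u) (Ioi 0)) {r : ℝ} (hr : 0 < r) :
    HasDerivAt m (solDeriv v ρ m r) r := by
  have h0 := two_I_mul_ne_zero hρ
  have hρ' : (ρ : ℂ) ≠ 0 := by exact_mod_cast hρ.ne'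
  have hc : ContinuousOn (fun u => v u * m u) (Ioi 0) := hv.mul (hm.continuousOn hρ hf)
  have hI1 := hasDerivAt_integral_Ioi (g := fun s => osc 0 ρ s * (v s * m s))
    (by simpa using integrableOn_osc_mul hf ρ 0) ((continuous_osc 0 ρ).continuousOn.mul hc) hr
  have hI2 := hasDerivAt_integral_Ioi hf hc hr
  have hneg : HasDerivAt (fun r => osc 0 ρ (-r)) (-(2 * Complex.I * ρ * osc 0 ρ (-r))) r := by
    simpa [Function.comp_def] using (hasDerivAt_osc_zero ρ (-r)).scomp r (hasDerivAt_neg r)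
  have hsol : ∀ u, solDeriv v ρ m u =
      -(osc 0 ρ (-u) * ∫ s in Ioi u, osc 0 ρ s * (v s * m s)) := by
    intro u
    rw [solDeriv, ← integral_const_mul]
    congr 2
    ext s
    rw [osc_zero_sub]
    ring
  have hd := ((((hneg.mul hI1).sub hI2).const_mul (2 * Complex.I * (ρ : ℂ))⁻¹).const_add 1)
  refine (hd.congr_deriv ?_).congr_of_eventuallyEq ?_
  · rw [hsol]
    have e := osc_zero_neg_mul_self ρ r
    have : osc 0 ρ (-r) * -(osc 0 ρ r * (v r * m r)) = -(v r * m r) := by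
      linear_combination (-(v r * m r)) * e
    rw [this]
    field_simp
    ring
  · filter_upwards [lt_mem_nhds hr] with u hu
    have := hm.sub_one_eq hρ hf hu.le
    rw [hsol, neg_neg] at this
    simp only [Pi.mul_apply, Pi.sub_apply]
    rw [← this]
    field_simp
    ring

lemma Decays.integrableOn {w : ℝ → ℂ} {C p : ℝ} (hw : Decays w C p) (hp : 1 < p) {r : ℝ}
    (hr : 0 ≤ r) : IntegrableOn w (Ioi r) := by
  refine Integrable.mono' ((integrableOn_one_add_rpow (a := -p) (by linarith) hr).const_mul C)
    (hw.1.mono_measure (Measure.restrict_mono (Ioi_subset_Ioi hr) le_rfl)) ?_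
  filter_upwards [ae_restrict_mem measurableSet_Ioi] with s hs
  exact hw.2.2 s (hr.trans_lt hs)

lemma norm_solDeriv_le (hv : IntegrableOn v (Ioi 0)) (hb : ∀ r, 0 < r → ‖m r‖ ≤ 2) {r : ℝ}
    (hr : 0 ≤ r) :
    ‖solDeriv v ρ m r‖ ≤ 2 * ∫ u in Ioi 0, ‖v u‖ := by
  rw [solDeriv, norm_neg]
  have h1 : ‖∫ s in Ioi r, osc 0 ρ (s - r) * (v s * m s)‖ ≤ ∫ s in Ioi r, 2 * ‖v s‖ := by
    refine norm_integral_le_of_norm_le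
      ((hv.mono_set (Ioi_subset_Ioi hr)).norm.const_mul 2) ?_
    filter_upwards [ae_restrict_mem measurableSet_Ioi] with s hs
    rw [norm_mul, norm_osc_zero, one_mul, norm_mul, mul_comm]
    gcongr
    exact hb s (hr.trans_lt hs)
  rw [integral_const_mul] at h1
  refine h1.trans (mul_le_mul_of_nonneg_left ?_ zero_le_two)
  exact setIntegral_mono_set hv.norm (Eventually.of_forall fun _ => norm_nonneg _)
    (Ioi_subset_Ioi hr).eventuallyLE

lemma Solves.solDeriv_eq (hm : Solves v ρ m) (hρ : 0 < ρ) (hv : Decays v C 4)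
    (hv' : Decays v' C 5) (hd : ∀ s, 0 < s → HasDerivAt v (v' s) s)
    (hf : IntegrableOn (fun u => v u * m u) (Ioi 0)) (hb : ∀ r, 0 < r → ‖m r‖ ≤ 2)
    {r : ℝ} (hr : 0 < r) :
    2 * Complex.I * ρ * solDeriv v ρ m r = v r * m r +
      (∫ s in Ioi r, osc 0 ρ (s - r) * v' s * m s) +
      ∫ s in Ioi r, osc 0 ρ (s - r) * v s * solDeriv v ρ m s := by
  have hvc : ContinuousOn v (Ioi 0) := fun s hs => (hd s hs).continuousAt.continuousWithinAt
  have hvi := hv.integrableOn (by norm_num) le_rfl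
  have hmc := hm.continuousOn hρ hf
  have hsub : Ioi r ⊆ Ioi 0 := Ioi_subset_Ioi hr.le
  have hi1 : IntegrableOn (fun s => v' s * m s) (Ioi r) := by
    refine ((hv'.integrableOn (by norm_num) hr.le).norm.const_mul 2).mono'
      ((hv'.1.mono_measure (Measure.restrict_mono hsub le_rfl)).mul
        ((hmc.mono hsub).aestronglyMeasurable measurableSet_Ioi)) ?_
    filter_upwards [ae_restrict_mem measurableSet_Ioi] with s hs
    rw [norm_mul, mul_comm]
    gcongr
    exact hb s (hsub hs)
  have hi2 : IntegrableOn (fun s => v s * solDeriv v ρ m s) (Ioi r) := by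
    refine ((hv.integrableOn (by norm_num) hr.le).norm.const_mul
      (2 * ∫ u in Ioi 0, ‖v u‖)).mono'
      ((hv.1.mono_measure (Measure.restrict_mono hsub le_rfl)).mul
        (((Solves.continuousOn_solDeriv hf).mono hsub).aestronglyMeasurable measurableSet_Ioi)) ?_
    filter_upwards [ae_restrict_mem measurableSet_Ioi] with s hs
    rw [norm_mul, mul_comm]
    gcongr
    exact norm_solDeriv_le hvi hb (hr.trans hs).le
  have hi0 := hf.mono_set hsub
  have hj0 := (integrableOn_osc_mul hi0 ρ r).const_mul (2 * Complex.I * (ρ : ℂ))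
  have hj1 := integrableOn_osc_mul hi1 ρ r
  have hj2 := integrableOn_osc_mul hi2 ρ r
  have hosc : ∀ s, HasDerivAt (fun s => osc 0 ρ (s - r))
      (2 * Complex.I * ρ * osc 0 ρ (s - r)) s := fun s =>
    HasDerivAt.comp_sub_const s r (hasDerivAt_osc_zero ρ (s - r))
  have hder : ∀ s ∈ Ici r, HasDerivAt (fun s => osc 0 ρ (s - r) * (v s * m s))
      (2 * Complex.I * ρ * (osc 0 ρ (s - r) * (v s * m s)) + osc 0 ρ (s - r) * (v' s * m s) +
        osc 0 ρ (s - r) * (v s * solDeriv v ρ m s)) s := by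
    intro s hs
    have hs0 : 0 < s := hr.trans_le hs
    refine ((hosc s).mul ((hd s hs0).mul (hm.hasDerivAt hρ hvc hf hs0))).congr_deriv ?_
    rw [Pi.mul_apply]
    ring
  have hlim : Tendsto (fun s => osc 0 ρ (s - r) * (v s * m s)) atTop (𝓝 0) := by
    have h1 : Tendsto (fun s : ℝ => C * 2 * (1 + s) ^ (-4 : ℝ)) atTop (𝓝 (C * 2 * 0)) :=
      ((tendsto_rpow_neg_atTop (by norm_num : (0 : ℝ) < 4)).comp
        (tendsto_atTop_add_const_left atTop (1 : ℝ) tendsto_id)).const_mul _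
    rw [mul_zero] at h1
    refine squeeze_zero_norm' ?_ h1
    filter_upwards [eventually_gt_atTop 0] with s hs
    rw [norm_mul, norm_osc_zero, one_mul, norm_mul]
    calc _ ≤ C * (1 + s) ^ (-4 : ℝ) * 2 :=
          mul_le_mul (hv.2.2 s hs) (hb s hs) (norm_nonneg _)
            (mul_nonneg hv.2.1 (Real.rpow_nonneg (by linarith) _))
      _ = _ := by ring
  have hj01 : IntegrableOn (fun s => 2 * Complex.I * ρ * (osc 0 ρ (s - r) * (v s * m s)) +
      osc 0 ρ (s - r) * (v' s * m s)) (Ioi r) := hj0.add hj1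
  have hftc := integral_Ioi_of_hasDerivAt_of_tendsto' hder (hj01.add hj2) hlim
  rw [integral_add hj01 hj2, integral_add hj0 hj1, integral_const_mul, sub_self, osc_zero] at hftc
  simp only [Complex.ofReal_zero, mul_zero, Complex.exp_zero, one_mul] at hftc
  simp only [mul_assoc] at hftc ⊢
  rw [solDeriv]
  linear_combination -hftc

end System

/-! ### Differentiability of solutions of resolvent equations -/

section Resolvent

variable {X : Type*} [NormedAddCommGroup X] [NormedSpace ℝ X]

lemma norm_le_two_mul_of_resolvent {T : X →L[ℝ] X} {ρ R : ℝ} {e f : X} (hR : R < ρ) (hρ : 1 ≤ ρ)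
    (hT : ‖T‖ ≤ R / 2) (h : ρ • e = f + T e) : ‖e‖ ≤ 2 * ‖f‖ := by
  have h1 : ρ * ‖e‖ ≤ ‖f‖ + R / 2 * ‖e‖ := by
    calc ρ * ‖e‖ = ‖ρ • e‖ := by rw [norm_smul, Real.norm_of_nonneg (by linarith)]
      _ ≤ ‖f‖ + ‖T e‖ := by rw [h]; exact norm_add_le _ _
      _ ≤ _ := by gcongr; exact T.le_of_opNorm_le hT e
  nlinarith [norm_nonneg e]

lemma exists_hasDerivAt_of_resolvent [CompleteSpace X] {A A' : ℝ → X →L[ℝ] X} {E F F' : ℝ → X}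
    {R : ℝ} (hR : 1 ≤ R) (hn : ∀ ρ, ‖A ρ‖ ≤ R / 2)
    (hE : ∀ ρ, R < ρ → ρ • E ρ = F ρ + A ρ (E ρ)) (hA : ∀ ρ, R < ρ → HasDerivAt A (A' ρ) ρ)
    (hF : ∀ ρ, R < ρ → HasDerivAt F (F' ρ) ρ) :
    ∃ E' : ℝ → X, ∀ ρ, R < ρ → HasDerivAt E (E' ρ) ρ ∧
      ρ • E' ρ = F' ρ + A' ρ (E ρ) - E ρ + A ρ (E' ρ) := by
  have hdiff : ∀ ρ, R < ρ → DifferentiableAt ℝ E ρ := by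
    intro ρ hρ
    have hlt : ∀ σ, R < σ → ‖σ⁻¹ • A σ‖ < 1 := by
      intro σ hσ
      have h0 : 0 < σ := by linarith
      rw [norm_smul, norm_inv, Real.norm_of_nonneg h0.le, inv_mul_lt_one₀ h0]
      exact (hn σ).trans_lt (by linarith)
    have hd : DifferentiableAt ℝ (fun σ => Ring.inverse (1 - σ⁻¹ • A σ) (σ⁻¹ • F σ)) ρ := by
      have hi : DifferentiableAt ℝ (fun σ : ℝ => σ⁻¹) ρ := differentiableAt_inv (by linarith)
      refine DifferentiableAt.clm_apply ?_ (hi.smul (hF ρ hρ).differentiableAt)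
      have h2 : DifferentiableAt ℝ (fun σ => 1 - σ⁻¹ • A σ) ρ :=
        (hi.smul (hA ρ hρ).differentiableAt).const_sub 1
      have h3 := (hasFDerivAt_ringInverse (𝕜 := ℝ)
        (Units.oneSub (ρ⁻¹ • A ρ) (hlt ρ hρ))).differentiableAt
      exact DifferentiableAt.comp ρ h3 h2
    refine hd.congr_of_eventuallyEq ?_
    filter_upwards [lt_mem_nhds hρ] with σ hσ
    have h0 : σ ≠ 0 := by linarith
    set U := Units.oneSub (σ⁻¹ • A σ) (hlt σ hσ) with hU
    have hUv : (U : X →L[ℝ] X) = 1 - σ⁻¹ • A σ := rfl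
    have h4 : σ⁻¹ • F σ = (U : X →L[ℝ] X) (E σ) := by
      have := hE σ hσ
      rw [← sub_eq_iff_eq_add] at this
      rw [hUv, ← this, smul_sub, smul_smul, inv_mul_cancel₀ h0]
      simp
    rw [h4, ← hUv, Ring.inverse_unit]
    change E σ = ((↑U⁻¹ : X →L[ℝ] X) * (U : X →L[ℝ] X)) (E σ)
    rw [Units.inv_mul]
    rfl
  refine ⟨deriv E, fun ρ hρ => ⟨(hdiff ρ hρ).hasDerivAt, ?_⟩⟩
  have hd := (hdiff ρ hρ).hasDerivAt
  have h1 := (hasDerivAt_id ρ).smul hd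
  have h2 := (hF ρ hρ).add ((hA ρ hρ).clm_apply hd)
  have h3 := h1.unique (h2.congr_of_eventuallyEq (by
    filter_upwards [lt_mem_nhds hρ] with σ hσ using hE σ hσ))
  simp only [id_eq, one_smul] at h3
  rw [← eq_sub_iff_add_eq] at h3
  rw [h3]
  abel

end Resolvent

section OscSystem

/-- The oscillatory part of the first-order system. -/
def oscPart (w₀ w₁ : ℝ → ℂ) (j : ℕ) (ρ : ℝ) : (ℝ →ᵇ ℂ) × (ℝ →ᵇ ℂ) →L[ℝ] (ℝ →ᵇ ℂ) :=
  oscOp w₁ 0 j ρ ∘L ContinuousLinearMap.fst ℝ _ _ + oscOp w₀ 0 j ρ ∘L ContinuousLinearMap.snd ℝ _ _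

/-- The oscillatory part of the first-order system as an endomorphism. -/
def oscSys (w₀ w₁ : ℝ → ℂ) (j : ℕ) (ρ : ℝ) :
    (ℝ →ᵇ ℂ) × (ℝ →ᵇ ℂ) →L[ℝ] (ℝ →ᵇ ℂ) × (ℝ →ᵇ ℂ) :=
  ContinuousLinearMap.inr ℝ (ℝ →ᵇ ℂ) (ℝ →ᵇ ℂ) ∘L oscPart w₀ w₁ j ρ

/-- The part of the first-order system which does not depend on the frequency. -/
def constSys (u : ℝ →ᵇ ℂ) (w₀ : ℝ → ℂ) : (ℝ →ᵇ ℂ) × (ℝ →ᵇ ℂ) →L[ℝ] (ℝ →ᵇ ℂ) × (ℝ →ᵇ ℂ) :=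
  ((-(2 * Complex.I)⁻¹) • ContinuousLinearMap.snd ℝ (ℝ →ᵇ ℂ) (ℝ →ᵇ ℂ) -
      oscOp w₀ 0 0 0 ∘L ContinuousLinearMap.fst ℝ _ _).prod
    (ContinuousLinearMap.mul ℝ (ℝ →ᵇ ℂ) u ∘L ContinuousLinearMap.fst ℝ _ _)

variable {w₀ w₁ : ℝ → ℂ} {C : ℝ}

lemma oscSys_apply (j : ℕ) (ρ : ℝ) (E : (ℝ →ᵇ ℂ) × (ℝ →ᵇ ℂ)) :
    oscSys w₀ w₁ j ρ E = (0, oscOp w₁ 0 j ρ E.1 + oscOp w₀ 0 j ρ E.2) := rfl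

lemma constSys_apply (u : ℝ →ᵇ ℂ) (E : (ℝ →ᵇ ℂ) × (ℝ →ᵇ ℂ)) :
    constSys u w₀ E = ((-(2 * Complex.I)⁻¹) • E.2 - oscOp w₀ 0 0 0 E.1, u * E.1) := rfl

lemma hasDerivAt_oscSys (hw₀ : Decays w₀ C 4) (hw₁ : Decays w₁ C 5) {j : ℕ} (hj : j ≤ 1) (ρ : ℝ) :
    HasDerivAt (oscSys w₀ w₁ j) (oscSys w₀ w₁ (j + 1) ρ) ρ := by
  have hj' : (j : ℝ) ≤ 1 := by exact_mod_cast hj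
  have h₁ : HasDerivAt (oscOp w₁ 0 j) (oscOp w₁ 0 (j + 1) ρ) ρ :=
    hasDerivAt_oscOp hw₁ (by linarith) (by linarith) ρ
  have h₀ : HasDerivAt (oscOp w₀ 0 j) (oscOp w₀ 0 (j + 1) ρ) ρ :=
    hasDerivAt_oscOp hw₀ (by linarith) (by linarith) ρ
  have := (hasDerivAt_const ρ (ContinuousLinearMap.inr ℝ (ℝ →ᵇ ℂ) (ℝ →ᵇ ℂ))).clm_comp
    ((h₁.clm_comp (hasDerivAt_const ρ (ContinuousLinearMap.fst ℝ (ℝ →ᵇ ℂ) (ℝ →ᵇ ℂ)))).add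
      (h₀.clm_comp (hasDerivAt_const ρ (ContinuousLinearMap.snd ℝ (ℝ →ᵇ ℂ) (ℝ →ᵇ ℂ)))))
  refine this.congr_deriv ?_
  simp [oscSys, oscPart]

lemma exists_norm_oscSys_le (hw₀ : Decays w₀ C 4) (hw₁ : Decays w₁ C 5) {j : ℕ} (hj : j ≤ 2) :
    ∃ B, ∀ ρ, ‖oscSys w₀ w₁ j ρ‖ ≤ B := by
  have hj' : (j : ℝ) ≤ 2 := by exact_mod_cast hj
  refine ⟨‖ContinuousLinearMap.inr ℝ (ℝ →ᵇ ℂ) (ℝ →ᵇ ℂ)‖ *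
    (2 ^ j * C / (5 - j - 1) * ‖ContinuousLinearMap.fst ℝ (ℝ →ᵇ ℂ) (ℝ →ᵇ ℂ)‖ +
     2 ^ j * C / (4 - j - 1) * ‖ContinuousLinearMap.snd ℝ (ℝ →ᵇ ℂ) (ℝ →ᵇ ℂ)‖), fun ρ => ?_⟩
  refine (ContinuousLinearMap.opNorm_comp_le _ _).trans ?_
  refine mul_le_mul_of_nonneg_left ((norm_add_le _ _).trans (add_le_add ?_ ?_)) (norm_nonneg _)
  · exact (ContinuousLinearMap.opNorm_comp_le _ _).trans (mul_le_mul_of_nonneg_right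
      (norm_oscOp_le hw₁ (by linarith) (by linarith) ρ) (norm_nonneg _))
  · exact (ContinuousLinearMap.opNorm_comp_le _ _).trans (mul_le_mul_of_nonneg_right
      (norm_oscOp_le hw₀ (by linarith) (by linarith) ρ) (norm_nonneg _))

lemma Decays.exists_bcf {w : ℝ → ℂ} {C p β : ℝ} (hw : Decays w C p) (hc : ContinuousOn w (Ioi 0))
    (hβ : β ≤ p) :
    ∃ u : ℝ →ᵇ ℂ, ∀ x, u x = ((1 + Real.exp x) ^ β : ℝ) * w (Real.exp x) := by
  refine ⟨BoundedContinuousFunction.ofNormedAddCommGroup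
    (fun x => (((1 + Real.exp x) ^ β : ℝ) : ℂ) * w (Real.exp x)) ?_ C ?_, fun x => rfl⟩
  · refine Continuous.mul ?_ (hc.comp_continuous Real.continuous_exp Real.exp_pos)
    refine Complex.continuous_ofReal.comp ?_
    exact Continuous.rpow_const (by fun_prop) fun x => Or.inl (by positivity)
  · intro x
    have h1 : 0 < 1 + Real.exp x := by positivity
    have h2 : 1 ≤ 1 + Real.exp x := by linarith [Real.exp_pos x]
    rw [norm_mul, Complex.norm_real, Real.norm_of_nonneg (by positivity)]
    calc (1 + Real.exp x) ^ β * ‖w (Real.exp x)‖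
        ≤ (1 + Real.exp x) ^ β * (C * (1 + Real.exp x) ^ (-p)) := by
          gcongr
          exact hw.2.2 _ (Real.exp_pos x)
      _ = C * (1 + Real.exp x) ^ (β - p) := by
          rw [sub_eq_add_neg, Real.rpow_add h1]
          ring
      _ ≤ C * 1 := mul_le_mul_of_nonneg_left
          (Real.rpow_le_one_of_one_le_of_nonpos h2 (by linarith)) hw.2.1
      _ = C := mul_one C

lemma Decays.div_one_add {w : ℝ → ℂ} {C p : ℝ} (hw : Decays w C p) :
    Decays (fun s => w s / ((1 + s : ℝ) : ℂ)) C (p + 1) := by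
  refine ⟨?_, hw.2.1, fun s hs => ?_⟩
  · simp only [div_eq_mul_inv]
    refine hw.1.mul (Measurable.aestronglyMeasurable ?_)
    fun_prop
  · have h1 : 0 < 1 + s := by linarith
    rw [norm_div, Complex.norm_real, Real.norm_of_nonneg h1.le, neg_add, Real.rpow_add h1,
      Real.rpow_neg_one, ← mul_assoc, div_eq_mul_inv]
    gcongr
    exact hw.2.2 s hs

/-- A factor `1 + s` may be moved from the weight to the argument of `oscOp`. -/
lemma oscOp_div_one_add {w : ℝ → ℂ} {C p β : ℝ} {j : ℕ} (hw : Decays w C p) (hj : j + 1 < p)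
    (hβ : β + j + 1 ≤ p) (ρ : ℝ) {φ ψ : ℝ →ᵇ ℂ}
    (h : ∀ x, ψ x = ((1 + Real.exp x : ℝ) : ℂ) * φ x) :
    oscOp (fun s => w s / ((1 + s : ℝ) : ℂ)) β j ρ ψ = oscOp w β j ρ φ := by
  ext x
  rw [oscOp_apply hw.div_one_add (by linarith) (by linarith), oscOp_apply hw hj hβ, volterra,
    volterra]
  congr 1
  refine setIntegral_congr_fun measurableSet_Ioi fun s hs => ?_
  have hs0 : 0 < s := (Real.exp_pos x).trans hs
  have h1 : ((1 + s : ℝ) : ℂ) ≠ 0 := by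
    have : 1 + s ≠ 0 := by linarith
    exact_mod_cast this
  simp only [h, Real.exp_log hs0]
  field_simp

/-- The weight exponent `β` multiplies the values of `oscOp` by `(1 + exp x) ^ β`. -/
lemma oscOp_weight {w : ℝ → ℂ} {C p β : ℝ} {j : ℕ} (hw : Decays w C p) (hj : j + 1 < p)
    (hβ : β + j + 1 ≤ p) (ρ : ℝ) (φ : ℝ →ᵇ ℂ) (x : ℝ) :
    oscOp w β j ρ φ x = ((1 + Real.exp x) ^ β : ℝ) * oscOp w 0 j ρ φ x := by
  rw [oscOp_apply hw hj hβ, oscOp_apply hw hj (by linarith), volterra, volterra, Real.rpow_zero,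
    Complex.ofReal_one, one_mul]

end OscSystem

/-! ### Uniform bounds for the derivatives of solutions of the system -/

section Boundedness

variable {X Y : Type*} [NormedAddCommGroup X] [NormedSpace ℝ X] [NormedAddCommGroup Y]
  [NormedSpace ℝ Y]

lemma isBigO_one_clm_apply {α : Type*} {l : Filter α} {T : α → X →L[ℝ] Y} {φ : α → X} {B : ℝ}
    (hT : ∀ a, ‖T a‖ ≤ B) (hφ : φ =O[l] fun _ => (1 : ℝ)) :
    (fun a => T a (φ a)) =O[l] fun _ => (1 : ℝ) := by
  refine (Asymptotics.IsBigO.of_bound B (Eventually.of_forall fun a => ?_)).trans hφ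
  exact (T a).le_of_opNorm_le (hT a) _

lemma isBigO_one_of_resolvent {A : ℝ → X →L[ℝ] X} {E F : ℝ → X} {R : ℝ} (hR : 1 ≤ R)
    (hn : ∀ ρ, ‖A ρ‖ ≤ R / 2) (hE : ∀ ρ, R < ρ → ρ • E ρ = F ρ + A ρ (E ρ))
    (hF : F =O[𝓟 (Ioi R)] fun _ => (1 : ℝ)) : E =O[𝓟 (Ioi R)] fun _ => (1 : ℝ) := by
  refine (Asymptotics.IsBigO.of_bound 2 ?_).trans hF
  rw [eventually_principal]
  exact fun ρ hρ => norm_le_two_mul_of_resolvent hρ (hR.trans (le_of_lt hρ)) (hn ρ) (hE ρ hρ)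

end Boundedness

section Bounds

variable {w₀ w₁ : ℝ → ℂ} {C R : ℝ} {u : ℝ →ᵇ ℂ} {E E₁ E₂ E₃ : ℝ → (ℝ →ᵇ ℂ) × (ℝ →ᵇ ℂ)}

lemma isBigO_one_oscOp {w : ℝ → ℂ} {p β : ℝ} {j : ℕ} (hw : Decays w C p) (hj : j + 1 < p)
    (hβ : β + j + 1 ≤ p) {l : Filter ℝ} {φ : ℝ → ℝ →ᵇ ℂ} (hφ : φ =O[l] fun _ => (1 : ℝ)) :
    (fun ρ => oscOp w β j ρ (φ ρ)) =O[l] fun _ => (1 : ℝ) :=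
  isBigO_one_clm_apply (norm_oscOp_le hw hj hβ) hφ

lemma isBigO_one_fst {l : Filter ℝ} (hE : E =O[l] fun _ => (1 : ℝ)) :
    (fun ρ => (E ρ).1) =O[l] fun _ => (1 : ℝ) :=
  (Asymptotics.IsBigO.of_norm_le fun ρ => norm_fst_le (E ρ)).trans hE.norm_left

lemma isBigO_one_snd {l : Filter ℝ} (hE : E =O[l] fun _ => (1 : ℝ)) :
    (fun ρ => (E ρ).2) =O[l] fun _ => (1 : ℝ) :=
  (Asymptotics.IsBigO.of_norm_le fun ρ => norm_snd_le (E ρ)).trans hE.norm_left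

lemma hasDerivAt_fst {ρ : ℝ} {E' : (ℝ →ᵇ ℂ) × (ℝ →ᵇ ℂ)} (h : HasDerivAt E E' ρ) :
    HasDerivAt (fun σ => (E σ).1) E'.1 ρ :=
  (ContinuousLinearMap.fst ℝ (ℝ →ᵇ ℂ) (ℝ →ᵇ ℂ)).hasFDerivAt.comp_hasDerivAt ρ h

lemma hasDerivAt_snd {ρ : ℝ} {E' : (ℝ →ᵇ ℂ) × (ℝ →ᵇ ℂ)} (h : HasDerivAt E E' ρ) :
    HasDerivAt (fun σ => (E σ).2) E'.2 ρ :=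
  (ContinuousLinearMap.snd ℝ (ℝ →ᵇ ℂ) (ℝ →ᵇ ℂ)).hasFDerivAt.comp_hasDerivAt ρ h

lemma hasDerivAt_eval {ρ : ℝ} {φ : ℝ → ℝ →ᵇ ℂ} {φ' : ℝ →ᵇ ℂ} (h : HasDerivAt φ φ' ρ) (x : ℝ) :
    HasDerivAt (fun σ => φ σ x) (φ' x) ρ :=
  (BoundedContinuousFunction.evalCLM ℝ x : (ℝ →ᵇ ℂ) →L[ℝ] ℂ).hasFDerivAt.comp_hasDerivAt ρ h

/-- The second component of a solution decays at least like `(1 + r)⁻¹`, together with its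
first derivative in the frequency. -/
lemma exists_weighted_snd (hw₀ : Decays w₀ C 4) (hw₁ : Decays w₁ C 5)
    (hc : ContinuousOn w₀ (Ioi 0)) (hu : ∀ x, u x = w₀ (Real.exp x)) (hR : 1 ≤ R)
    (hE : ∀ ρ, R < ρ → ρ • E ρ = ρ • (1, 0) + (constSys u w₀ + oscSys w₀ w₁ 0 ρ) (E ρ))
    (hd : ∀ ρ, R < ρ → HasDerivAt E (E₁ ρ) ρ) (hb : E =O[𝓟 (Ioi R)] fun _ => (1 : ℝ)) :
    ∃ ψ ψ₁ : ℝ → ℝ →ᵇ ℂ, (∀ ρ, R < ρ → HasDerivAt ψ (ψ₁ ρ) ρ) ∧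
      (ψ =O[𝓟 (Ioi R)] fun _ => (1 : ℝ)) ∧
      ∀ ρ, R < ρ → ∀ x, ψ ρ x = ((1 + Real.exp x : ℝ) : ℂ) * (E ρ).2 x ∧
        ψ₁ ρ x = ((1 + Real.exp x : ℝ) : ℂ) * (E₁ ρ).2 x := by
  obtain ⟨u₁, hu₁⟩ := hw₀.exists_bcf (β := 1) hc (by norm_num)
  set χ : ℝ → ℝ →ᵇ ℂ := fun ρ =>
    ContinuousLinearMap.mul ℝ (ℝ →ᵇ ℂ) u₁ (E ρ).1 + oscOp w₁ 1 0 ρ (E ρ).1 +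
      oscOp w₀ 1 0 ρ (E ρ).2 with hχ
  have hdχ : ∀ ρ, R < ρ → DifferentiableAt ℝ χ ρ := by
    intro ρ hρ
    have h1 := hasDerivAt_fst (hd ρ hρ)
    have h2 := hasDerivAt_snd (hd ρ hρ)
    have h3 := hasDerivAt_oscOp (β := 1) (j := 0) hw₁ (by norm_num) (by norm_num) ρ
    have h4 := hasDerivAt_oscOp (β := 1) (j := 0) hw₀ (by norm_num) (by norm_num) ρ
    exact ((((ContinuousLinearMap.mul ℝ (ℝ →ᵇ ℂ) u₁).hasFDerivAt.comp_hasDerivAt ρ h1).add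
      (h3.clm_apply h1)).add (h4.clm_apply h2)).differentiableAt
  have hψ : ∀ ρ, R < ρ → ∀ x, ρ⁻¹ • χ ρ x = ((1 + Real.exp x : ℝ) : ℂ) * (E ρ).2 x := by
    intro ρ hρ x
    have h0 : ρ ≠ 0 := by linarith
    have h1 := congrArg (fun e => e.2 x) (hE ρ hρ)
    simp only [add_apply, constSys_apply, oscSys_apply, Prod.snd_add,
      Prod.smul_snd, BoundedContinuousFunction.coe_add, BoundedContinuousFunction.coe_smul,
      Pi.add_apply, BoundedContinuousFunction.coe_mul, Pi.mul_apply, smul_zero, zero_add, hu] at h1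
    rw [← inv_smul_smul₀ h0 ((E ρ).2 x), h1]
    simp only [hχ, ContinuousLinearMap.mul_apply', BoundedContinuousFunction.coe_add,
      Pi.add_apply, BoundedContinuousFunction.coe_mul, Pi.mul_apply, hu₁]
    rw [oscOp_weight hw₁ (by norm_num) (by norm_num), oscOp_weight hw₀ (by norm_num) (by norm_num),
      Real.rpow_one, Complex.real_smul, Complex.real_smul]
    ring
  have hdψ : ∀ ρ, R < ρ → DifferentiableAt ℝ (fun σ => σ⁻¹ • χ σ) ρ := fun ρ hρ =>
    (differentiableAt_inv (by linarith)).smul (hdχ ρ hρ)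
  refine ⟨fun ρ => ρ⁻¹ • χ ρ, deriv fun ρ => ρ⁻¹ • χ ρ, fun ρ hρ => (hdψ ρ hρ).hasDerivAt, ?_,
    fun ρ hρ x => ⟨hψ ρ hρ x, ?_⟩⟩
  · have h1 : χ =O[𝓟 (Ioi R)] fun _ => (1 : ℝ) :=
      ((isBigO_one_clm_apply (fun _ => le_rfl) (isBigO_one_fst hb)).add
        (isBigO_one_oscOp hw₁ (by norm_num) (by norm_num) (isBigO_one_fst hb))).add
        (isBigO_one_oscOp hw₀ (by norm_num) (by norm_num) (isBigO_one_snd hb))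
    refine (Asymptotics.IsBigO.of_bound 1 ?_).trans h1
    rw [eventually_principal]
    intro ρ hρ
    have hρ' : 1 ≤ ρ := hR.trans (le_of_lt hρ)
    rw [norm_smul, norm_inv, Real.norm_of_nonneg (by linarith)]
    gcongr
    exact inv_le_one_of_one_le₀ hρ'
  · have h1 := hasDerivAt_eval (hdψ ρ hρ).hasDerivAt x
    have h2 := (hasDerivAt_eval (hasDerivAt_snd (hd ρ hρ)) x).const_mul
      ((1 + Real.exp x : ℝ) : ℂ)
    refine h1.unique (h2.congr_of_eventuallyEq ?_)
    filter_upwards [lt_mem_nhds hρ] with σ hσ using hψ σ hσ x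

set_option maxHeartbeats 400000 in
/-- Three derivatives in the frequency of a solution of the first-order system, with the
differentiated equations. -/
lemma exists_hasDerivAt_system (hw₀ : Decays w₀ C 4) (hw₁ : Decays w₁ C 5)
    (hc : ContinuousOn w₀ (Ioi 0)) (hu : ∀ x, u x = w₀ (Real.exp x)) (hR : 1 ≤ R)
    (hn : ∀ ρ, ‖constSys u w₀ + oscSys w₀ w₁ 0 ρ‖ ≤ R / 2)
    (hE : ∀ ρ, R < ρ → ρ • E ρ = ρ • (1, 0) + (constSys u w₀ + oscSys w₀ w₁ 0 ρ) (E ρ)) :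
    ∃ (E₁ E₂ E₃ : ℝ → (ℝ →ᵇ ℂ) × (ℝ →ᵇ ℂ)) (ψ : ℝ → ℝ →ᵇ ℂ),
      ((E =O[𝓟 (Ioi R)] fun _ => (1 : ℝ)) ∧ (E₁ =O[𝓟 (Ioi R)] fun _ => (1 : ℝ)) ∧
        (E₂ =O[𝓟 (Ioi R)] fun _ => (1 : ℝ)) ∧ (E₃ =O[𝓟 (Ioi R)] fun _ => (1 : ℝ)) ∧
        (ψ =O[𝓟 (Ioi R)] fun _ => (1 : ℝ))) ∧
      ∀ ρ, R < ρ → (HasDerivAt E (E₁ ρ) ρ ∧ HasDerivAt E₁ (E₂ ρ) ρ ∧ HasDerivAt E₂ (E₃ ρ) ρ) ∧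
        (∀ x, ψ ρ x = ((1 + Real.exp x : ℝ) : ℂ) * (E ρ).2 x) ∧
        (ρ • E₁ ρ = (1, 0) + oscSys w₀ w₁ 1 ρ (E ρ) - E ρ +
          (constSys u w₀ + oscSys w₀ w₁ 0 ρ) (E₁ ρ)) ∧
        (ρ • E₂ ρ = oscSys w₀ w₁ 2 ρ (E ρ) + 2 • oscSys w₀ w₁ 1 ρ (E₁ ρ) - 2 • E₁ ρ +
          (constSys u w₀ + oscSys w₀ w₁ 0 ρ) (E₂ ρ)) ∧
        (ρ • E₃ ρ = (0, oscOp w₁ 0 3 ρ (E ρ).1 +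
            oscOp (fun s => w₀ s / ((1 + s : ℝ) : ℂ)) 0 3 ρ (ψ ρ)) +
          3 • oscSys w₀ w₁ 2 ρ (E₁ ρ) + 3 • oscSys w₀ w₁ 1 ρ (E₂ ρ) - 3 • E₂ ρ +
          (constSys u w₀ + oscSys w₀ w₁ 0 ρ) (E₃ ρ)) := by
  have hA : ∀ ρ, HasDerivAt (fun σ => constSys u w₀ + oscSys w₀ w₁ 0 σ) (oscSys w₀ w₁ 1 ρ) ρ :=
    fun ρ => HasDerivAt.const_add (F := (ℝ →ᵇ ℂ) × (ℝ →ᵇ ℂ) →L[ℝ] (ℝ →ᵇ ℂ) × (ℝ →ᵇ ℂ)) _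
      (hasDerivAt_oscSys hw₀ hw₁ zero_le_one ρ)
  have hA₁ := hasDerivAt_oscSys hw₀ hw₁ le_rfl
  obtain ⟨B₁, hB₁⟩ := exists_norm_oscSys_le hw₀ hw₁ one_le_two
  obtain ⟨B₂, hB₂⟩ := exists_norm_oscSys_le hw₀ hw₁ le_rfl
  have hw₀' : Decays (fun s => w₀ s / ((1 + s : ℝ) : ℂ)) C 5 := by
    have := hw₀.div_one_add
    norm_num at this ⊢
    exact this
  have one_isBigO : ∀ e : (ℝ →ᵇ ℂ) × (ℝ →ᵇ ℂ), (fun _ : ℝ => e) =O[𝓟 (Ioi R)] fun _ => (1 : ℝ) :=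
    fun e => Asymptotics.isBigO_const_const _ one_ne_zero _
  have hb : E =O[𝓟 (Ioi R)] fun _ => (1 : ℝ) := by
    have h1 := isBigO_one_of_resolvent (E := fun ρ => E ρ - (1, 0)) hR hn
      (F := fun ρ => (constSys u w₀ + oscSys w₀ w₁ 0 ρ) (1, 0))
      (fun ρ hρ => by rw [smul_sub, hE ρ hρ, map_sub]; abel)
      (isBigO_one_clm_apply hn (one_isBigO (1, 0)))
    simpa using h1.add (one_isBigO (1, 0))
  obtain ⟨E₁, hE₁⟩ := exists_hasDerivAt_of_resolvent hR hn hE (fun ρ _ => hA ρ)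
    (F' := fun _ => (1, 0)) (fun ρ _ => by
      simpa using (hasDerivAt_id ρ).smul_const ((1, 0) : (ℝ →ᵇ ℂ) × (ℝ →ᵇ ℂ)))
  have hb₁ : E₁ =O[𝓟 (Ioi R)] fun _ => (1 : ℝ) :=
    isBigO_one_of_resolvent hR hn (fun ρ hρ => (hE₁ ρ hρ).2)
      (((one_isBigO _).add (isBigO_one_clm_apply hB₁ hb)).sub hb)
  obtain ⟨E₂, hE₂⟩ := exists_hasDerivAt_of_resolvent hR hn (fun ρ hρ => (hE₁ ρ hρ).2)
    (fun ρ _ => hA ρ) (fun ρ hρ =>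
      (((hA₁ ρ).clm_apply (hE₁ ρ hρ).1).const_add ((1, 0) : (ℝ →ᵇ ℂ) × (ℝ →ᵇ ℂ))).sub
        (hE₁ ρ hρ).1)
  have hb₂ : E₂ =O[𝓟 (Ioi R)] fun _ => (1 : ℝ) :=
    isBigO_one_of_resolvent hR hn (fun ρ hρ => (hE₂ ρ hρ).2)
      (((((isBigO_one_clm_apply hB₂ hb).add (isBigO_one_clm_apply hB₁ hb₁)).sub hb₁).add
        (isBigO_one_clm_apply hB₁ hb₁)).sub hb₁)
  obtain ⟨ψ, ψ₁, hψd, hψb, hψ⟩ := exists_weighted_snd hw₀ hw₁ hc hu hR hE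
    (fun ρ hρ => (hE₁ ρ hρ).1) hb
  have hA₂ : ∀ ρ, R < ρ → HasDerivAt (fun σ => oscSys w₀ w₁ 2 σ (E σ))
      ((0, oscOp w₁ 0 3 ρ (E ρ).1 + oscOp (fun s => w₀ s / ((1 + s : ℝ) : ℂ)) 0 3 ρ (ψ ρ)) +
        oscSys w₀ w₁ 2 ρ (E₁ ρ)) ρ := by
    intro ρ hρ
    have h1 : HasDerivAt (oscOp w₁ 0 2) (oscOp w₁ 0 3 ρ) ρ :=
      hasDerivAt_oscOp (j := 2) hw₁ (by norm_num) (by norm_num) ρ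
    have h2 : HasDerivAt (oscOp (fun s => w₀ s / ((1 + s : ℝ) : ℂ)) 0 2)
        (oscOp (fun s => w₀ s / ((1 + s : ℝ) : ℂ)) 0 3 ρ) ρ :=
      hasDerivAt_oscOp (j := 2) hw₀' (by norm_num) (by norm_num) ρ
    have h3 := (hasDerivAt_const ρ (0 : ℝ →ᵇ ℂ)).prodMk
      ((h1.clm_apply (hasDerivAt_fst (hE₁ ρ hρ).1)).add (h2.clm_apply (hψd ρ hρ)))
    refine (h3.congr_deriv ?_).congr_of_eventuallyEq ?_
    · rw [oscOp_div_one_add hw₀ (by norm_num) (by norm_num) ρ fun x => (hψ ρ hρ x).2,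
        oscSys_apply, Prod.mk_add_mk, add_zero]
      congr 1
      abel
    · filter_upwards [lt_mem_nhds hρ] with σ hσ
      rw [oscSys_apply]
      congr 2
      exact (oscOp_div_one_add hw₀ (by norm_num) (by norm_num) σ fun x => (hψ σ hσ x).1).symm
  obtain ⟨E₃, hE₃⟩ := exists_hasDerivAt_of_resolvent hR hn (fun ρ hρ => (hE₂ ρ hρ).2)
    (fun ρ _ => hA ρ) (fun ρ hρ =>
      ((((hA₂ ρ hρ).add ((hA₁ ρ).clm_apply (hE₂ ρ hρ).1)).sub (hE₂ ρ hρ).1).add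
        ((hA₁ ρ).clm_apply (hE₂ ρ hρ).1)).sub (hE₂ ρ hρ).1)
  have hbD : (fun ρ => ((0, oscOp w₁ 0 3 ρ (E ρ).1 +
      oscOp (fun s => w₀ s / ((1 + s : ℝ) : ℂ)) 0 3 ρ (ψ ρ)) : (ℝ →ᵇ ℂ) × (ℝ →ᵇ ℂ)))
      =O[𝓟 (Ioi R)] fun _ => (1 : ℝ) :=
    isBigO_one_clm_apply (T := fun _ => ContinuousLinearMap.inr ℝ (ℝ →ᵇ ℂ) (ℝ →ᵇ ℂ))
      (fun _ => le_rfl) ((isBigO_one_oscOp hw₁ (by norm_num) (by norm_num) (isBigO_one_fst hb)).add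
        (isBigO_one_oscOp hw₀' (by norm_num) (by norm_num) hψb))
  have h12 : (fun ρ => oscSys w₀ w₁ 2 ρ (E₁ ρ) + oscSys w₀ w₁ 1 ρ (E₂ ρ))
      =O[𝓟 (Ioi R)] fun _ => (1 : ℝ) :=
    (isBigO_one_clm_apply hB₂ hb₁).add (isBigO_one_clm_apply hB₁ hb₂)
  have hb₃ : E₃ =O[𝓟 (Ioi R)] fun _ => (1 : ℝ) :=
    isBigO_one_of_resolvent hR hn (fun ρ hρ => (hE₃ ρ hρ).2)
      (((((((hbD.add (isBigO_one_clm_apply hB₂ hb₁)).add h12).sub hb₂).add h12).sub hb₂).add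
        (isBigO_one_clm_apply hB₁ hb₂)).sub hb₂)
  refine ⟨E₁, E₂, E₃, ψ, ⟨hb, hb₁, hb₂, hb₃, hψb⟩, fun ρ hρ =>
    ⟨⟨(hE₁ ρ hρ).1, (hE₂ ρ hρ).1, (hE₃ ρ hρ).1⟩, fun x => (hψ ρ hρ x).1, (hE₁ ρ hρ).2, ?_, ?_⟩⟩
  · rw [(hE₂ ρ hρ).2]
    abel
  · rw [(hE₃ ρ hρ).2]
    abel

/-- The spatial weight `(1 + r) ^ a` with `r = exp q.2`, as a function of the pair `q = (ρ, x)`. -/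
def wt (a : ℝ) (q : ℝ × ℝ) : ℝ := (1 + Real.exp q.2) ^ a

lemma wt_isBigO {a b : ℝ} (h : a ≤ b) (l : Filter (ℝ × ℝ)) : wt a =O[l] wt b := by
  refine Asymptotics.IsBigO.of_norm_le fun q => ?_
  have h1 : 1 ≤ 1 + Real.exp q.2 := by linarith [Real.exp_pos q.2]
  rw [wt, wt, Real.norm_of_nonneg (by positivity)]
  exact Real.rpow_le_rpow_of_exponent_le h1 h

lemma isBigO_of_mul {f : ℝ × ℝ → ℂ} {k : ℝ × ℝ → ℝ} (hR : 1 ≤ R)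
    (h : (fun q => q.1 * f q) =O[𝓟 (Ioi R ×ˢ univ)] k) : f =O[𝓟 (Ioi R ×ˢ univ)] k := by
  refine (Asymptotics.IsBigO.of_bound 1 ?_).trans h
  rw [eventually_principal]
  rintro q ⟨hq, -⟩
  have h1 : 1 ≤ q.1 := hR.trans (le_of_lt hq)
  rw [one_mul, norm_mul, Complex.norm_real, Real.norm_of_nonneg (by linarith)]
  exact le_mul_of_one_le_left (norm_nonneg _) h1

lemma isBigO_of_eq {f g : ℝ × ℝ → ℂ} {k : ℝ × ℝ → ℝ}
    (hg : g =O[𝓟 (Ioi R ×ˢ univ)] k) (h : ∀ ρ, R < ρ → ∀ x, f (ρ, x) = g (ρ, x)) :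
    f =O[𝓟 (Ioi R ×ˢ univ)] k := by
  refine hg.congr' ?_ EventuallyEq.rfl
  rw [EventuallyEq, eventually_principal]
  rintro ⟨ρ, x⟩ ⟨hq, -⟩
  exact (h ρ hq x).symm

lemma isBigO_norm_comp_fst {φ : ℝ → ℝ →ᵇ ℂ} (hφ : φ =O[𝓟 (Ioi R)] fun _ => (1 : ℝ)) :
    (fun q : ℝ × ℝ => ‖φ q.1‖) =O[𝓟 (Ioi R ×ˢ univ)] fun _ => (1 : ℝ) :=
  (hφ.comp_tendsto (tendsto_principal_principal.2 fun _ hq => hq.1)).norm_left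

lemma isBigO_oscOp {w : ℝ → ℂ} {p β : ℝ} {j : ℕ} (hw : Decays w C p) (hj : j + 1 < p)
    (hβ : β + j + 1 ≤ p) {a : ℝ} (ha : β + j + 1 - p ≤ a) (σ : ℝ → ℝ) {φ : ℝ → ℝ →ᵇ ℂ}
    (hφ : φ =O[𝓟 (Ioi R)] fun _ => (1 : ℝ)) :
    (fun q : ℝ × ℝ => oscOp w β j (σ q.1) (φ q.1) q.2) =O[𝓟 (Ioi R ×ˢ univ)] wt a := by
  have h1 : (fun q : ℝ × ℝ => oscOp w β j (σ q.1) (φ q.1) q.2) =O[𝓟 (Ioi R ×ˢ univ)]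
      fun q => wt (β + j + 1 - p) q * ‖φ q.1‖ := by
    refine Asymptotics.IsBigO.of_bound (2 ^ j * C / (p - j - 1)) (Eventually.of_forall fun q => ?_)
    have h2 : 0 ≤ wt (β + j + 1 - p) q := by unfold wt; positivity
    rw [Real.norm_of_nonneg (mul_nonneg h2 (norm_nonneg _)), ← mul_assoc]
    exact norm_oscOp_apply_le hw hj hβ _ _ _
  refine h1.trans ?_
  simpa using (wt_isBigO ha _).mul (isBigO_norm_comp_fst hφ)

lemma isBigO_weight_mul {p : ℝ} (hw : Decays w₀ C p) (hu : ∀ x, u x = w₀ (Real.exp x))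
    {φ : ℝ → ℝ →ᵇ ℂ} (hφ : φ =O[𝓟 (Ioi R)] fun _ => (1 : ℝ)) {a : ℝ} (ha : -p ≤ a) :
    (fun q : ℝ × ℝ => u q.2 * φ q.1 q.2) =O[𝓟 (Ioi R ×ˢ univ)] wt a := by
  have h1 : (fun q : ℝ × ℝ => u q.2) =O[𝓟 (Ioi R ×ˢ univ)] wt (-p) := by
    refine Asymptotics.IsBigO.of_bound C (Eventually.of_forall fun q => ?_)
    rw [wt, Real.norm_of_nonneg (by positivity), hu]
    exact hw.2.2 _ (Real.exp_pos _)
  have h2 : (fun q : ℝ × ℝ => φ q.1 q.2) =O[𝓟 (Ioi R ×ˢ univ)] fun _ => (1 : ℝ) :=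
    (Asymptotics.IsBigO.of_bound 1 (Eventually.of_forall fun q => by
      simpa using (φ q.1).norm_coe_le_norm q.2)).trans (isBigO_norm_comp_fst hφ)
  simpa using (h1.trans (wt_isBigO ha _)).mul h2

/-- Pointwise bounds for a solution of the first-order system and its first three derivatives in
the frequency. -/
theorem exists_hasDerivAt_isBigO (hw₀ : Decays w₀ C 4) (hw₁ : Decays w₁ C 5)
    (hc : ContinuousOn w₀ (Ioi 0)) (hu : ∀ x, u x = w₀ (Real.exp x)) (hR : 1 ≤ R)
    (hn : ∀ ρ, ‖constSys u w₀ + oscSys w₀ w₁ 0 ρ‖ ≤ R / 2)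
    (hE : ∀ ρ, R < ρ → ρ • E ρ = ρ • (1, 0) + (constSys u w₀ + oscSys w₀ w₁ 0 ρ) (E ρ)) :
    ∃ E₁ E₂ E₃ : ℝ → (ℝ →ᵇ ℂ) × (ℝ →ᵇ ℂ),
      (∀ ρ, R < ρ → HasDerivAt E (E₁ ρ) ρ ∧ HasDerivAt E₁ (E₂ ρ) ρ ∧ HasDerivAt E₂ (E₃ ρ) ρ) ∧
      ((fun q : ℝ × ℝ => q.1 * (E q.1).2 q.2) =O[𝓟 (Ioi R ×ˢ univ)] wt (-4)) ∧
      ((fun q : ℝ × ℝ => q.1 * ((E q.1).1 q.2 - 1)) =O[𝓟 (Ioi R ×ˢ univ)] wt (-3)) ∧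
      ((fun q : ℝ × ℝ => q.1 * (E₁ q.1).1 q.2) =O[𝓟 (Ioi R ×ˢ univ)] wt (-3)) ∧
      ((fun q : ℝ × ℝ => q.1 * (E₂ q.1).1 q.2) =O[𝓟 (Ioi R ×ˢ univ)] wt (-2)) ∧
      ((fun q : ℝ × ℝ => q.1 * (E₃ q.1).1 q.2) =O[𝓟 (Ioi R ×ˢ univ)] wt (-1)) := by
  obtain ⟨E₁, E₂, E₃, ψ, ⟨hb, hb₁, hb₂, hb₃, hψb⟩, h⟩ :=
    exists_hasDerivAt_system hw₀ hw₁ hc hu hR hn hE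
  have hw₀' : Decays (fun s => w₀ s / ((1 + s : ℝ) : ℂ)) C 5 := by
    have := hw₀.div_one_add
    norm_num at this ⊢
    exact this
  have hK₁ : ∀ (j : ℕ) (a : ℝ), j ≤ 3 → j - 4 ≤ a → ∀ φ : ℝ → ℝ →ᵇ ℂ,
      (φ =O[𝓟 (Ioi R)] fun _ => (1 : ℝ)) →
      (fun q : ℝ × ℝ => oscOp w₁ 0 j q.1 (φ q.1) q.2) =O[𝓟 (Ioi R ×ˢ univ)] wt a := by
    intro j a hj ha φ hφ
    have hj' : (j : ℝ) ≤ 3 := by exact_mod_cast hj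
    exact isBigO_oscOp hw₁ (by linarith) (by linarith) (by linarith) id hφ
  have hK₀ : ∀ (j : ℕ) (a : ℝ), j ≤ 2 → j - 3 ≤ a → ∀ φ : ℝ → ℝ →ᵇ ℂ,
      (φ =O[𝓟 (Ioi R)] fun _ => (1 : ℝ)) →
      (fun q : ℝ × ℝ => oscOp w₀ 0 j q.1 (φ q.1) q.2) =O[𝓟 (Ioi R ×ˢ univ)] wt a := by
    intro j a hj ha φ hφ
    have hj' : (j : ℝ) ≤ 2 := by exact_mod_cast hj
    exact isBigO_oscOp hw₀ (by linarith) (by linarith) (by linarith) id hφ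
  have hψ₀ : ∀ (j : ℕ) (a : ℝ), j ≤ 3 → j - 4 ≤ a →
      (fun q : ℝ × ℝ => oscOp (fun s => w₀ s / ((1 + s : ℝ) : ℂ)) 0 j q.1 (ψ q.1) q.2)
        =O[𝓟 (Ioi R ×ˢ univ)] wt a := by
    intro j a hj ha
    have hj' : (j : ℝ) ≤ 3 := by exact_mod_cast hj
    exact isBigO_oscOp hw₀' (by linarith) (by linarith) (by linarith) id hψb
  have hψ₁ : ∀ (j : ℕ) (a : ℝ), j ≤ 2 → j - 4 ≤ a →
      (fun q : ℝ × ℝ => oscOp w₀ 0 j q.1 (E q.1).2 q.2) =O[𝓟 (Ioi R ×ˢ univ)] wt a := by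
    intro j a hj ha
    have hj' : (j : ℝ) ≤ 2 := by exact_mod_cast hj
    refine isBigO_of_eq (hψ₀ j a (by omega) ha) fun ρ hρ x => ?_
    rw [oscOp_div_one_add hw₀ (by linarith) (by linarith) ρ (h ρ hρ).2.1]
  have hU : ∀ (a : ℝ), -4 ≤ a → ∀ φ : ℝ → ℝ →ᵇ ℂ, (φ =O[𝓟 (Ioi R)] fun _ => (1 : ℝ)) →
      (fun q : ℝ × ℝ => u q.2 * φ q.1 q.2) =O[𝓟 (Ioi R ×ˢ univ)] wt a :=
    fun a ha φ hφ => isBigO_weight_mul hw₀ hu hφ ha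
  have hP : ∀ (a : ℝ), -3 ≤ a → ∀ φ : ℝ → ℝ →ᵇ ℂ, (φ =O[𝓟 (Ioi R)] fun _ => (1 : ℝ)) →
      (fun q : ℝ × ℝ => oscOp w₀ 0 0 0 (φ q.1) q.2) =O[𝓟 (Ioi R ×ˢ univ)] wt a :=
    fun a ha φ hφ => isBigO_oscOp hw₀ (by norm_num) (by norm_num)
      (by norm_num; linarith) (fun _ => 0) hφ
  have hb' := isBigO_one_fst hb
  have hb₁' := isBigO_one_fst hb₁
  have hb₂' := isBigO_one_fst hb₂
  have hb₃' := isBigO_one_fst hb₃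
  have hc₁ := isBigO_one_snd hb₁
  have hc₂ := isBigO_one_snd hb₂
  have hc₃ := isBigO_one_snd hb₃
  have hs₀ : (fun q : ℝ × ℝ => q.1 * (E q.1).2 q.2) =O[𝓟 (Ioi R ×ˢ univ)] wt (-4) := by
    refine isBigO_of_eq ((hU _ le_rfl _ hb').add ((hK₁ 0 _ (by norm_num) (by norm_num) _ hb').add
      (hψ₁ 0 _ (by norm_num) (by norm_num)))) fun ρ hρ x => ?_
    have := congrArg (fun e => e.2 x) (hE ρ hρ)
    simpa [constSys_apply, oscSys_apply] using this
  have hs₁ : (fun q : ℝ × ℝ => q.1 * (E₁ q.1).2 q.2) =O[𝓟 (Ioi R ×ˢ univ)] wt (-3) := by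
    refine isBigO_of_eq ((((hK₁ 1 _ (by norm_num) (by norm_num) _ hb').add
      (hψ₁ 1 _ (by norm_num) (by norm_num))).sub
      ((isBigO_of_mul hR hs₀).trans (wt_isBigO (by norm_num) _))).add
      ((hU _ (by norm_num) _ hb₁').add ((hK₁ 0 _ (by norm_num) (by norm_num) _ hb₁').add
      (hK₀ 0 _ (by norm_num) (by norm_num) _ hc₁)))) fun ρ hρ x => ?_
    have := congrArg (fun e => e.2 x) (h ρ hρ).2.2.1
    simpa [constSys_apply, oscSys_apply] using this
  have hs₂ : (fun q : ℝ × ℝ => q.1 * (E₂ q.1).2 q.2) =O[𝓟 (Ioi R ×ˢ univ)] wt (-2) := by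
    refine isBigO_of_eq (((((hK₁ 2 _ (by norm_num) (by norm_num) _ hb').add
      (hψ₁ 2 _ (by norm_num) (by norm_num))).add
      (((hK₁ 1 _ (by norm_num) (by norm_num) _ hb₁').add
      (hK₀ 1 _ (by norm_num) (by norm_num) _ hc₁)).const_mul_left 2)).sub
      (((isBigO_of_mul hR hs₁).trans (wt_isBigO (by norm_num) _)).const_mul_left 2)).add
      ((hU _ (by norm_num) _ hb₂').add ((hK₁ 0 _ (by norm_num) (by norm_num) _ hb₂').add
      (hK₀ 0 _ (by norm_num) (by norm_num) _ hc₂)))) fun ρ hρ x => ?_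
    have := congrArg (fun e => e.2 x) (h ρ hρ).2.2.2.1
    simpa [constSys_apply, oscSys_apply, mul_add] using this
  have hs₃ : (fun q : ℝ × ℝ => q.1 * (E₃ q.1).2 q.2) =O[𝓟 (Ioi R ×ˢ univ)] wt (-1) := by
    refine isBigO_of_eq ((((((hK₁ 3 _ (by norm_num) (by norm_num) _ hb').add
      (hψ₀ 3 _ (by norm_num) (by norm_num))).add
      (((hK₁ 2 _ (by norm_num) (by norm_num) _ hb₁').add
      (hK₀ 2 _ (by norm_num) (by norm_num) _ hc₁)).const_mul_left 3)).add
      (((hK₁ 1 _ (by norm_num) (by norm_num) _ hb₂').add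
      (hK₀ 1 _ (by norm_num) (by norm_num) _ hc₂)).const_mul_left 3)).sub
      (((isBigO_of_mul hR hs₂).trans (wt_isBigO (by norm_num) _)).const_mul_left 3)).add
      ((hU _ (by norm_num) _ hb₃').add ((hK₁ 0 _ (by norm_num) (by norm_num) _ hb₃').add
      (hK₀ 0 _ (by norm_num) (by norm_num) _ hc₃)))) fun ρ hρ x => ?_
    have := congrArg (fun e => e.2 x) (h ρ hρ).2.2.2.2
    simpa [constSys_apply, oscSys_apply, mul_add] using this
  have hf₀ : (fun q : ℝ × ℝ => q.1 * ((E q.1).1 q.2 - 1)) =O[𝓟 (Ioi R ×ˢ univ)] wt (-3) := by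
    refine isBigO_of_eq ((((isBigO_of_mul hR hs₀).trans
      (wt_isBigO (by norm_num) _)).const_mul_left (-(2 * Complex.I)⁻¹)).sub
      (hP _ le_rfl _ hb')) fun ρ hρ x => ?_
    have := congrArg (fun e => e.1 x) (hE ρ hρ)
    simp [constSys_apply, oscSys_apply] at this ⊢
    linear_combination this
  have hf₁ : (fun q : ℝ × ℝ => q.1 * (E₁ q.1).1 q.2) =O[𝓟 (Ioi R ×ˢ univ)] wt (-3) := by
    refine isBigO_of_eq (((((isBigO_of_mul hR hs₁).const_mul_left (-(2 * Complex.I)⁻¹)).sub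
      (hP _ le_rfl _ hb₁'))).sub (isBigO_of_mul hR hf₀)) fun ρ hρ x => ?_
    have := congrArg (fun e => e.1 x) (h ρ hρ).2.2.1
    simp [constSys_apply, oscSys_apply] at this ⊢
    linear_combination this
  have hf₂ : (fun q : ℝ × ℝ => q.1 * (E₂ q.1).1 q.2) =O[𝓟 (Ioi R ×ˢ univ)] wt (-2) := by
    refine isBigO_of_eq (((((isBigO_of_mul hR hs₂).const_mul_left (-(2 * Complex.I)⁻¹)).sub
      (hP _ (by norm_num) _ hb₂'))).sub (((isBigO_of_mul hR hf₁).trans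
      (wt_isBigO (by norm_num) _)).const_mul_left 2)) fun ρ hρ x => ?_
    have := congrArg (fun e => e.1 x) (h ρ hρ).2.2.2.1
    simp [constSys_apply, oscSys_apply] at this ⊢
    linear_combination this
  have hf₃ : (fun q : ℝ × ℝ => q.1 * (E₃ q.1).1 q.2) =O[𝓟 (Ioi R ×ˢ univ)] wt (-1) := by
    refine isBigO_of_eq (((((isBigO_of_mul hR hs₃).const_mul_left (-(2 * Complex.I)⁻¹)).sub
      (hP _ (by norm_num) _ hb₃'))).sub (((isBigO_of_mul hR hf₂).trans
      (wt_isBigO (by norm_num) _)).const_mul_left 3)) fun ρ hρ x => ?_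
    have := congrArg (fun e => e.1 x) (h ρ hρ).2.2.2.2
    simp [constSys_apply, oscSys_apply] at this ⊢
    linear_combination this
  exact ⟨E₁, E₂, E₃, fun ρ hρ => (h ρ hρ).1, hs₀, hf₀, hf₁, hf₂, hf₃⟩

end Bounds

/-! ### The system for the modified Jost function -/

section Jost

variable {v v' : ℝ → ℂ} {C R : ℝ}

lemma Decays.mono {w : ℝ → ℂ} {C' p : ℝ} (hw : Decays w C p) (h : C ≤ C') : Decays w C' p :=
  ⟨hw.1, hw.2.1.trans h, fun s hs => (hw.2.2 s hs).trans (by gcongr)⟩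

lemma Decays.div_two_I {w : ℝ → ℂ} {p : ℝ} (hw : Decays w C p) :
    Decays (fun s => w s / (2 * Complex.I)) C p := by
  refine ⟨?_, hw.2.1, fun s hs => ?_⟩
  · simp only [div_eq_mul_inv]
    exact hw.1.mul_const _
  · refine le_trans ?_ (hw.2.2 s hs)
    rw [norm_div, norm_mul, Complex.norm_I, mul_one, Complex.norm_two]
    exact half_le_self (norm_nonneg _)

lemma oscOp_zero_apply {w f : ℝ → ℂ} {p : ℝ} (hw : Decays w C p) (hp : 1 < p) (ρ : ℝ) {φ : ℝ →ᵇ ℂ}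
    (hφ : ∀ x, φ x = f (Real.exp x)) (x : ℝ) :
    oscOp (fun s => w s / (2 * Complex.I)) 0 0 ρ φ x =
      (2 * Complex.I)⁻¹ * ∫ s in Ioi (Real.exp x), osc 0 ρ (s - Real.exp x) * w s * f s := by
  have hp0 : ((0 : ℕ) : ℝ) + 1 < p := by simpa using hp
  rw [oscOp_apply hw.div_two_I hp0 (by linarith), volterra, Real.rpow_zero,
    Complex.ofReal_one, one_mul, ← integral_const_mul]
  refine setIntegral_congr_fun measurableSet_Ioi fun s hs => ?_
  have hs0 : 0 < s := (Real.exp_pos x).trans hs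
  simp only [hφ, Real.exp_log hs0]
  ring

/-- The curve `ρ ↦ (m(·,ρ), ∂ᵣ m(·,ρ))` solves the first-order system. -/
lemma exists_system_of_solves {m : ℝ → ℝ → ℂ} (hv : Decays v C 4) (hv' : Decays v' C 5)
    (hd : ∀ s, 0 < s → HasDerivAt v (v' s) s) {u : ℝ →ᵇ ℂ}
    (hu : ∀ x, u x = v (Real.exp x) / (2 * Complex.I)) (hR : 1 ≤ R)
    (hK : 2 * ∫ s in Ioi 0, ‖v s‖ ≤ R) (hm : ∀ ρ, R < ρ → Solves v ρ (m ρ)) :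
    ∃ E : ℝ → (ℝ →ᵇ ℂ) × (ℝ →ᵇ ℂ),
      (∀ ρ, R < ρ → ∀ x, (E ρ).1 x = m ρ (Real.exp x) ∧
        (E ρ).2 x = deriv (m ρ) (Real.exp x)) ∧
      ∀ ρ, R < ρ → ρ • E ρ = ρ • (1, 0) + (constSys u (fun s => v s / (2 * Complex.I)) +
        oscSys (fun s => v s / (2 * Complex.I)) (fun s => v' s / (2 * Complex.I)) 0 ρ) (E ρ) := by
  have hvi := hv.integrableOn (by norm_num) le_rfl
  have hvc : ContinuousOn v (Ioi 0) := fun s hs => (hd s hs).continuousAt.continuousWithinAt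
  have hf : ∀ ρ, R < ρ → IntegrableOn (fun s => v s * m ρ s) (Ioi 0) := fun ρ hρ =>
    (hm ρ hρ).integrableOn (by linarith) hvi (hK.trans hρ.le)
  have hb : ∀ ρ, R < ρ → ∀ r, 0 < r → ‖m ρ r‖ ≤ 2 := fun ρ hρ r hr =>
    (hm ρ hρ).norm_le_two_of_integrableOn (by linarith) hvi (hK.trans hρ.le) le_rfl hr.le
      (hf ρ hρ)
  have hE : ∀ ρ : ℝ, ∃ e : (ℝ →ᵇ ℂ) × (ℝ →ᵇ ℂ), R < ρ → ∀ x, e.1 x = m ρ (Real.exp x) ∧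
      e.2 x = solDeriv v ρ (m ρ) (Real.exp x) := by
    intro ρ
    by_cases hρ : R < ρ
    · refine ⟨(BoundedContinuousFunction.ofNormedAddCommGroup (fun x => m ρ (Real.exp x))
        (((hm ρ hρ).continuousOn (by linarith) (hf ρ hρ)).comp_continuous Real.continuous_exp
          Real.exp_pos) 2 fun x => hb ρ hρ _ (Real.exp_pos x),
        BoundedContinuousFunction.ofNormedAddCommGroup
          (fun x => solDeriv v ρ (m ρ) (Real.exp x))
          ((Solves.continuousOn_solDeriv (hf ρ hρ)).comp_continuous Real.continuous_exp
            Real.exp_pos) (2 * ∫ s in Ioi 0, ‖v s‖)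
          fun x => norm_solDeriv_le hvi (hb ρ hρ) (Real.exp_pos x).le),
        fun _ x => ⟨rfl, rfl⟩⟩
    · exact ⟨0, fun h => absurd h hρ⟩
  choose E hE using hE
  refine ⟨E, fun ρ hρ x => ⟨(hE ρ hρ x).1, ?_⟩, fun ρ hρ => ?_⟩
  · rw [(hE ρ hρ x).2, ((hm ρ hρ).hasDerivAt (by linarith) hvc (hf ρ hρ) (Real.exp_pos x)).deriv]
  · have hρ0 : 0 < ρ := by linarith
    have h1 := fun x => (hE ρ hρ x).1
    have h2 := fun x => (hE ρ hρ x).2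
    have hI : Complex.I * Complex.I⁻¹ = 1 := mul_inv_cancel₀ Complex.I_ne_zero
    refine Prod.ext ?_ ?_ <;> ext x
    · have e := (hm ρ hρ).sub_one_eq hρ0 (hf ρ hρ) (Real.exp_pos x).le
      have e1 := oscOp_zero_apply hv (by norm_num) 0 h1 x
      simp only [osc_zero, Complex.ofReal_zero, mul_zero, zero_mul, Complex.exp_zero,
        one_mul] at e1
      simp only [constSys_apply, oscSys_apply, add_apply, Prod.fst_add, Prod.smul_fst, add_zero,
        BoundedContinuousFunction.coe_add, BoundedContinuousFunction.coe_sub, Pi.add_apply,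
        Pi.sub_apply, BoundedContinuousFunction.coe_smul, BoundedContinuousFunction.coe_one,
        Pi.one_apply, e1, h1, h2, Complex.real_smul, smul_eq_mul]
      linear_combination (2 * Complex.I)⁻¹ * e - ρ * (m ρ (Real.exp x) - 1) * hI
    · have e := (hm ρ hρ).solDeriv_eq hρ0 hv hv' hd (hf ρ hρ) (hb ρ hρ) (Real.exp_pos x)
      have e1 := oscOp_zero_apply hv' (by norm_num) ρ h1 x
      have e2 := oscOp_zero_apply hv (by norm_num) ρ h2 x
      simp only [constSys_apply, oscSys_apply, add_apply, Prod.snd_add, Prod.smul_snd, smul_zero,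
        zero_add, BoundedContinuousFunction.coe_add, Pi.add_apply,
        BoundedContinuousFunction.coe_smul, BoundedContinuousFunction.coe_mul, Pi.mul_apply,
        e1, e2, h1, h2, hu, Complex.real_smul]
      linear_combination (2 * Complex.I)⁻¹ * e - ρ * solDeriv v ρ (m ρ) (Real.exp x) * hI

lemma iteratedDeriv_eq_of_hasDerivAt {f f₁ f₂ f₃ : ℝ → ℂ} (h : ∀ ρ, R < ρ →
    HasDerivAt f (f₁ ρ) ρ ∧ HasDerivAt f₁ (f₂ ρ) ρ ∧ HasDerivAt f₂ (f₃ ρ) ρ) {ρ : ℝ} (hρ : R < ρ) :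
    iteratedDeriv 1 f ρ = f₁ ρ ∧ iteratedDeriv 2 f ρ = f₂ ρ ∧ iteratedDeriv 3 f ρ = f₃ ρ := by
  have h1 : ∀ σ, R < σ → iteratedDeriv 1 f σ = f₁ σ := fun σ hσ => by
    rw [iteratedDeriv_one, (h σ hσ).1.deriv]
  have h2 : ∀ σ, R < σ → iteratedDeriv 2 f σ = f₂ σ := fun σ hσ => by
    rw [iteratedDeriv_succ, EventuallyEq.deriv_eq (f := f₁), (h σ hσ).2.1.deriv]
    filter_upwards [lt_mem_nhds hσ] with τ hτ using h1 τ hτ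
  refine ⟨h1 ρ hρ, h2 ρ hρ, ?_⟩
  rw [iteratedDeriv_succ, EventuallyEq.deriv_eq (f := f₂), (h ρ hρ).2.2.deriv]
  filter_upwards [lt_mem_nhds hρ] with τ hτ using h2 τ hτ

end Jost

/-! ### Comparison of the Japanese bracket with `1 + r` -/

lemma one_le_jbR (r : ℝ) : 1 ≤ jbR r := Real.one_le_sqrt.2 (by nlinarith)

lemma jbR_le_one_add {r : ℝ} (hr : 0 ≤ r) : jbR r ≤ 1 + r :=
  (Real.sqrt_le_left (by linarith)).2 (by nlinarith)

lemma one_add_le_two_mul_jbR (r : ℝ) : 1 + r ≤ 2 * jbR r := by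
  have h1 := one_le_jbR r
  have h2 : r ≤ jbR r := Real.le_sqrt_of_sq_le (by linarith)
  linarith

lemma jbR_rpow_neg_le {r a : ℝ} (hr : 0 ≤ r) (ha : 0 ≤ a) :
    jbR r ^ (-a) ≤ 2 ^ a * (1 + r) ^ (-a) := by
  have h1 := one_le_jbR r
  have h2 := one_add_le_two_mul_jbR r
  have h3 : ((1 + r) / 2) ^ a ≤ jbR r ^ a := Real.rpow_le_rpow (by linarith) (by linarith) ha
  rw [Real.rpow_neg (by linarith), Real.rpow_neg (by linarith), ← div_eq_mul_inv,
    ← one_div_div, ← Real.div_rpow (by linarith) zero_le_two, ← one_div]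
  exact one_div_le_one_div_of_le (Real.rpow_pos_of_pos (by linarith) _) h3

lemma one_add_rpow_neg_le {r a : ℝ} (hr : 0 ≤ r) (ha : a ≤ 0) : (1 + r) ^ a ≤ jbR r ^ a :=
  Real.rpow_le_rpow_of_nonpos (by linarith [one_le_jbR r]) (jbR_le_one_add hr) ha

lemma decays_of_abs_le {W : ℝ → ℝ} {K a : ℝ} (hW : AEStronglyMeasurable W (volume.restrict (Ioi 0)))
    (ha : 0 ≤ a) (hK : ∀ r, 0 < r → |W r| ≤ K * jbR r ^ (-a)) :
    Decays (fun s => (W s : ℂ)) (|K| * 2 ^ a) a := by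
  refine ⟨Complex.continuous_ofReal.comp_aestronglyMeasurable hW, by positivity, fun s hs => ?_⟩
  rw [Complex.norm_real, Real.norm_eq_abs]
  have h0 : 0 ≤ jbR s ^ (-a) := Real.rpow_nonneg (by linarith [one_le_jbR s]) _
  calc |W s| ≤ K * jbR s ^ (-a) := hK s hs
    _ ≤ |K| * jbR s ^ (-a) := by gcongr; exact le_abs_self K
    _ ≤ |K| * (2 ^ a * (1 + s) ^ (-a)) := by gcongr; exact jbR_rpow_neg_le hs.le ha
    _ = _ := by ring

/-- Convert an asymptotic bound on `ρ • f` in the half-plane `ρ > R` into an explicit one. -/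
lemma exists_norm_le_of_isBigO {R a : ℝ} (hR : 1 ≤ R) (ha : a ≤ 0) {f : ℝ × ℝ → ℂ}
    (h : (fun q => q.1 * f q) =O[𝓟 (Ioi R ×ˢ univ)] wt a) :
    ∃ K, 0 ≤ K ∧ ∀ ρ, R < ρ → ∀ r, 0 < r →
      ‖f (ρ, Real.log r)‖ ≤ K * ρ⁻¹ * jbR r ^ a := by
  obtain ⟨K, hK, h⟩ := h.exists_nonneg
  rw [Asymptotics.isBigOWith_principal] at h
  refine ⟨K, hK, fun ρ hρ r hr => ?_⟩
  have h1 := h (ρ, Real.log r) ⟨hρ, mem_univ _⟩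
  have hρ0 : 0 < ρ := by linarith
  rw [norm_mul, Complex.norm_real, Real.norm_of_nonneg hρ0.le, wt, Real.exp_log hr,
    Real.norm_of_nonneg (by positivity)] at h1
  have h2 : K * (1 + r) ^ a ≤ K * jbR r ^ a :=
    mul_le_mul_of_nonneg_left (one_add_rpow_neg_le hr.le ha) hK
  calc ‖f (ρ, Real.log r)‖ = ρ⁻¹ * (ρ * ‖f (ρ, Real.log r)‖) := by field_simp
    _ ≤ ρ⁻¹ * (K * jbR r ^ a) := mul_le_mul_of_nonneg_left (h1.trans h2) (by positivity)
    _ = _ := by ring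

end JostBounds

/-- Lemma A.1: bounds for the modified Jost function.

Let `V : (0,∞) → ℝ` satisfy `|V(r)| ≲ ⟨r⟩^{-4}` and `|V′(r)| ≲ ⟨r⟩^{-5}`, and let
`m(r,ρ)` solve the Volterra integral equation
`m(r,ρ) = 1 + ∫_r^∞ ((e^{2iρ(r′−r)} − 1)/(2iρ)) V(r′) m(r′,ρ) dr′` for `r ≥ 0`
(so that `f(r,ρ) = e^{irρ} m(r,ρ)` is the Jost solution).  Then for all `r > 0` and all
sufficiently large `ρ`:
`|m(r,ρ) − 1| ≲ ρ^{-1}⟨r⟩^{-3}`, `|∂_r m(r,ρ)| ≲ ρ^{-1}⟨r⟩^{-4}`, and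
`|∂_ρ^ℓ m(r,ρ)| ≲ ρ^{-1}⟨r⟩^{-4+ℓ}` for `ℓ = 1, 2, 3`, with constants depending only
on `V`. -/
theorem statement_8
    (V : ℝ → ℝ)
    (hV : ∃ C : ℝ, ∀ r : ℝ, 0 < r → |V r| ≤ C * jbR r ^ (-4 : ℝ))
    (hV' : ∃ C : ℝ, ∀ r : ℝ, 0 < r → (DifferentiableAt ℝ V r ∧
      |deriv V r| ≤ C * jbR r ^ (-5 : ℝ)))
    (m : ℝ → ℝ → ℂ)
    (hm : ∀ ρ : ℝ, 0 < ρ → ∀ r : ℝ, 0 ≤ r →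
      m r ρ = 1 + ∫ r' in Ioi r,
        ((Complex.exp (2 * Complex.I * (ρ : ℂ) * ((r' - r : ℝ) : ℂ)) - 1) /
            (2 * Complex.I * (ρ : ℂ))) * ((V r' : ℝ) : ℂ) * m r' ρ) :
    ∃ C ρ0 : ℝ, 0 < C ∧ 0 < ρ0 ∧
      ∀ ρ : ℝ, ρ0 ≤ ρ → ∀ r : ℝ, 0 < r →
        ‖m r ρ - 1‖ ≤ C * ρ⁻¹ * jbR r ^ (-3 : ℝ) ∧
        ‖deriv (fun r' : ℝ => m r' ρ) r‖ ≤ C * ρ⁻¹ * jbR r ^ (-4 : ℝ) ∧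
        ∀ ℓ : ℕ, 1 ≤ ℓ → ℓ ≤ 3 →
          ‖iteratedDeriv ℓ (fun ρ' : ℝ => m r ρ') ρ‖ ≤
            C * ρ⁻¹ * jbR r ^ (-4 + (ℓ : ℝ)) := by
  obtain ⟨K₀, hK₀⟩ := hV
  obtain ⟨K₁, hK₁⟩ := hV'
  set v : ℝ → ℂ := fun s => (V s : ℂ) with hv_def
  set v' : ℝ → ℂ := fun s => ((deriv V s : ℝ) : ℂ) with hv'_def
  have hd : ∀ s, 0 < s → HasDerivAt v (v' s) s := fun s hs =>
    (hK₁ s hs).1.hasDerivAt.ofReal_comp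
  have hVc : ContinuousOn V (Ioi 0) := fun s hs =>
    (hK₁ s hs).1.continuousAt.continuousWithinAt
  have hvc : ContinuousOn v (Ioi 0) := Complex.continuous_ofReal.comp_continuousOn hVc
  have hv₀ : JostBounds.Decays v (|K₀| * 2 ^ (4 : ℝ)) 4 := JostBounds.decays_of_abs_le
    (hVc.aestronglyMeasurable measurableSet_Ioi) (by norm_num) hK₀
  have hv₁ : JostBounds.Decays v' (|K₁| * 2 ^ (5 : ℝ)) 5 := JostBounds.decays_of_abs_le
    (measurable_deriv V).aestronglyMeasurable (by norm_num) fun r hr => (hK₁ r hr).2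
  set C := max (|K₀| * 2 ^ (4 : ℝ)) (|K₁| * 2 ^ (5 : ℝ))
  replace hv₀ : JostBounds.Decays v C 4 := hv₀.mono (le_max_left _ _)
  replace hv₁ : JostBounds.Decays v' C 5 := hv₁.mono (le_max_right _ _)
  have hw₀ := hv₀.div_two_I
  have hw₁ := hv₁.div_two_I
  have hwc : ContinuousOn (fun s => v s / (2 * Complex.I)) (Ioi 0) := hvc.div_const _
  obtain ⟨u, hu⟩ := hw₀.exists_bcf (β := 0) hwc (by norm_num)
  simp only [Real.rpow_zero, Complex.ofReal_one, one_mul] at hu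
  obtain ⟨B, hB⟩ := JostBounds.exists_norm_oscSys_le hw₀ hw₁ (j := 0) (by norm_num)
  obtain ⟨R, hR⟩ : ∃ R, R = max 1 (max (2 * ∫ s in Ioi 0, ‖v s‖)
      (2 * (‖JostBounds.constSys u fun s => v s / (2 * Complex.I)‖ + B))) := ⟨_, rfl⟩
  have hR1 : 1 ≤ R := hR ▸ le_max_left _ _
  have hRK : 2 * ∫ s in Ioi 0, ‖v s‖ ≤ R :=
    hR ▸ (le_max_left _ _).trans (le_max_right _ _)
  have hRB : 2 * (‖JostBounds.constSys u fun s => v s / (2 * Complex.I)‖ + B) ≤ R :=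
    hR ▸ (le_max_right _ _).trans (le_max_right _ _)
  obtain ⟨E, hEm, hE⟩ := JostBounds.exists_system_of_solves (m := fun ρ r => m r ρ) hv₀ hv₁ hd hu
    hR1 hRK fun ρ hρ r hr => hm ρ (by linarith) r hr
  obtain ⟨E₁, E₂, E₃, hder, hs₀, hf₀, hf₁, hf₂, hf₃⟩ :=
    JostBounds.exists_hasDerivAt_isBigO hw₀ hw₁ hwc hu hR1
      (fun ρ => (norm_add_le _ _).trans (by linarith [hB ρ])) hE
  obtain ⟨N, hN, hs₀⟩ := JostBounds.exists_norm_le_of_isBigO hR1 (by norm_num) hs₀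
  obtain ⟨N₀, hN₀, hf₀⟩ := JostBounds.exists_norm_le_of_isBigO hR1 (by norm_num) hf₀
  obtain ⟨N₁, hN₁, hf₁⟩ := JostBounds.exists_norm_le_of_isBigO hR1 (by norm_num) hf₁
  obtain ⟨N₂, hN₂, hf₂⟩ := JostBounds.exists_norm_le_of_isBigO hR1 (by norm_num) hf₂
  obtain ⟨N₃, hN₃, hf₃⟩ := JostBounds.exists_norm_le_of_isBigO hR1 (by norm_num) hf₃
  refine ⟨N + N₀ + N₁ + N₂ + N₃ + 1, R + 1, by positivity, by linarith, fun ρ hρ r hr => ?_⟩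
  have hρR : R < ρ := by linarith
  have hρ0 : 0 < ρ := by linarith
  have hmono : ∀ {a x K : ℝ}, x ≤ K * ρ⁻¹ * jbR r ^ a → K ≤ N + N₀ + N₁ + N₂ + N₃ + 1 →
      x ≤ (N + N₀ + N₁ + N₂ + N₃ + 1) * ρ⁻¹ * jbR r ^ a := by
    intro a x K hx hK
    have h0 : 0 ≤ jbR r ^ a := Real.rpow_nonneg (Real.sqrt_nonneg _) _
    exact hx.trans (by gcongr)
  have hg : ∀ σ, R < σ → (E σ).1 (Real.log r) = m r σ := fun σ hσ => by
    rw [(hEm σ hσ _).1, Real.exp_log hr]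
  have hh : (E ρ).2 (Real.log r) = deriv (fun r' => m r' ρ) r := by
    rw [(hEm ρ hρR _).2, Real.exp_log hr]
  obtain ⟨h1, h2, h3⟩ := JostBounds.iteratedDeriv_eq_of_hasDerivAt (f := fun σ => m r σ)
    (f₁ := fun σ => (E₁ σ).1 (Real.log r)) (f₂ := fun σ => (E₂ σ).1 (Real.log r))
    (f₃ := fun σ => (E₃ σ).1 (Real.log r)) (R := R) (fun σ hσ => by
      obtain ⟨d1, d2, d3⟩ := hder σ hσ
      refine ⟨?_, JostBounds.hasDerivAt_eval (JostBounds.hasDerivAt_fst d2) _,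
        JostBounds.hasDerivAt_eval (JostBounds.hasDerivAt_fst d3) _⟩
      refine (JostBounds.hasDerivAt_eval (JostBounds.hasDerivAt_fst d1)
        (Real.log r)).congr_of_eventuallyEq ?_
      filter_upwards [lt_mem_nhds hσ] with τ hτ using (hg τ hτ).symm) hρR
  refine ⟨?_, ?_, fun ℓ hℓ₁ hℓ₃ => ?_⟩
  · rw [← hg ρ hρR]
    exact hmono (hf₀ ρ hρR r hr) (by linarith)
  · rw [← hh]
    exact hmono (hs₀ ρ hρR r hr) (by linarith)
  · interval_cases ℓ
    · rw [h1]
      convert hmono (hf₁ ρ hρR r hr) (by linarith) using 2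
      norm_num
    · rw [h2]
      convert hmono (hf₂ ρ hρR r hr) (by linarith) using 2
      norm_num
    · rw [h3]
      convert hmono (hf₃ ρ hρR r hr) (by linarith) using 2
      norm_num

end
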